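/- arXiv:1701.00377 — 4 statements merged into one kernel-verified Lean document; each statement's English description precedes it below -/
import Mathlib

section
/- Let G be a group and let H be a subgroup of G of finite index. If H embeds in IET, then G embeds in IET. -/
/-- The half-open unit interval `[0,1)` as a subset of `ℝ`. -/
abbrev I01 : Set ℝ := Set.Ico (0 : ℝ) 1

/-- A bijection of `[0,1)` is an interval exchange transformation if there are finitely many
points `0 = a 0 < a 1 < … < a n = 1` such that on each `[a i, a (i+1))` it is a translation. -/
def IsIET (T : Equiv.Perm I01) : Prop :=
  ∃ (n : ℕ) (a : Fin (n + 1) → ℝ), StrictMono a ∧ a 0 = 0 ∧ a (Fin.last n) = 1 ∧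
    ∀ i : Fin n, ∃ c : ℝ, ∀ x : I01, (x : ℝ) ∈ Set.Ico (a i.castSucc) (a i.succ) →
      ((T x : ℝ)) = (x : ℝ) + c

/-- Two-point form of the interval exchange condition, with a finite set of break points. -/
def GoodF (T : Equiv.Perm I01) (F : Finset ℝ) : Prop :=
  ∀ x y : I01, (x : ℝ) ≤ y → (∀ f ∈ F, ¬ ((x : ℝ) < f ∧ f ≤ y)) →
    (T y : ℝ) - T x = (y : ℝ) - x

lemma IsIET.exists_good {T : Equiv.Perm I01} (h : IsIET T) : ∃ F, GoodF T F := by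
  classical
  obtain ⟨n, a, ha, h0, h1, hc⟩ := h
  refine ⟨Finset.univ.image a, fun x y hxy hF => ?_⟩
  have hne : (Finset.univ.filter (fun j => a j ≤ (x : ℝ))).Nonempty :=
    ⟨0, by simp [h0, x.2.1]⟩
  obtain ⟨j, hj, hmax⟩ := Finset.exists_max_image _ id hne
  simp only [Finset.mem_filter, Finset.mem_univ, true_and, id] at hj hmax
  have hjl : j ≠ Fin.last n := by
    rintro rfl
    have := x.2.2
    linarith
  obtain ⟨i, rfl⟩ := Fin.exists_castSucc_eq.2 hjl
  have hx : (x : ℝ) < a i.succ := by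
    by_contra hcon
    have := hmax _ (not_lt.1 hcon)
    exact absurd this (not_le.2 Fin.castSucc_lt_succ)
  have hy : (y : ℝ) < a i.succ := by
    by_contra hcon
    exact hF (a i.succ) (by simp) ⟨hx, not_lt.1 hcon⟩
  obtain ⟨c, hc⟩ := hc i
  rw [hc x ⟨hj, hx⟩, hc y ⟨hj.trans hxy, hy⟩]
  ring

lemma GoodF.isIET {T : Equiv.Perm I01} {F : Finset ℝ} (h : GoodF T F) : IsIET T := by
  classical
  let S : Finset ℝ := insert 0 (insert 1 (F.filter (fun f => 0 ≤ f ∧ f ≤ 1)))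
  have hS : ∀ f ∈ S, 0 ≤ f ∧ f ≤ 1 := by
    intro f hf
    simp only [S, Finset.mem_insert, Finset.mem_filter] at hf
    rcases hf with rfl | rfl | hf
    · simp
    · simp
    · exact hf.2
  have hpos : 0 < S.card := Finset.card_pos.2 ⟨0, by simp [S]⟩
  obtain ⟨n, hn⟩ : ∃ n, S.card = n + 1 := ⟨S.card - 1, by omega⟩
  let a := S.orderEmbOfFin hn
  have hsurj : ∀ f ∈ S, ∃ j, a j = f := by
    intro f hf
    have : f ∈ Set.range a := by
      rw [Finset.range_orderEmbOfFin]; exact hf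
    exact this
  have hmem : ∀ j, a j ∈ S := fun j => Finset.orderEmbOfFin_mem S hn j
  have hmono : StrictMono a := a.strictMono
  have a0 : a 0 = 0 := by
    obtain ⟨j, hj⟩ := hsurj 0 (by simp [S])
    have := hmono.monotone (Fin.zero_le j)
    have := (hS _ (hmem 0)).1
    linarith
  have a1 : a (Fin.last n) = 1 := by
    obtain ⟨j, hj⟩ := hsurj 1 (by simp [S])
    have := hmono.monotone (Fin.le_last j)
    have := (hS _ (hmem (Fin.last n))).2
    linarith
  refine ⟨n, a, hmono, a0, a1, fun i => ?_⟩
  have hi : a i.castSucc ∈ I01 :=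
    ⟨(hS _ (hmem _)).1, a1 ▸ hmono (Fin.castSucc_lt_last i)⟩
  refine ⟨(T ⟨_, hi⟩ : ℝ) - a i.castSucc, fun x hx => ?_⟩
  have := h ⟨_, hi⟩ x hx.1 (fun f hf hfx => by
    obtain ⟨j, hj⟩ := hsurj f (by
      have h1 : a i.castSucc < f := hfx.1
      have := hi.1
      have := x.2.2
      simp only [S, Finset.mem_insert, Finset.mem_filter]
      exact Or.inr (Or.inr ⟨hf, by linarith, by linarith [hfx.2]⟩))
    subst hj
    have h1 : i.castSucc < j := hmono.lt_iff_lt.1 hfx.1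
    have h2 : j < i.succ := hmono.lt_iff_lt.1 (lt_of_le_of_lt hfx.2 hx.2)
    rw [Fin.lt_def] at h1 h2
    simp at h1 h2
    omega)
  simp only at this
  linarith

/-- Gluing `k` copies of `[0,1)` into one. -/
noncomputable def glue (k : ℕ) (hk : 0 < k) : Fin k × I01 ≃ I01 where
  toFun p := ⟨((p.1 : ℕ) + (p.2 : ℝ)) / k, by
    have hk' : (0 : ℝ) < k := by exact_mod_cast hk
    have h1 : ((p.1 : ℕ) : ℝ) + 1 ≤ k := by exact_mod_cast p.1.2
    have h2 := p.2.2.1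
    have h3 := p.2.2.2
    constructor
    · positivity
    · rw [div_lt_one hk']; linarith⟩
  invFun z := (⟨⌊(k : ℝ) * z⌋₊, by
    have hk' : (0 : ℝ) < k := by exact_mod_cast hk
    have h2 := z.2.1
    rw [Nat.floor_lt (by positivity)]
    have := z.2.2
    nlinarith⟩, ⟨(k : ℝ) * z - ⌊(k : ℝ) * z⌋₊, by
    have hk' : (0 : ℝ) < k := by exact_mod_cast hk
    have h2 := z.2.1
    have h3 := Nat.floor_le (a := (k : ℝ) * z) (by positivity)
    have h4 := Nat.lt_floor_add_one ((k : ℝ) * z)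
    constructor <;> linarith⟩)
  left_inv := by
    rintro ⟨i, x⟩
    have hk' : (k : ℝ) ≠ 0 := by exact_mod_cast hk.ne'
    have h1 : (k : ℝ) * (((i : ℕ) + (x : ℝ)) / k) = (i : ℕ) + (x : ℝ) := by field_simp
    have h2 : ⌊((i : ℕ) : ℝ) + (x : ℝ)⌋₊ = i := by
      rw [Nat.floor_eq_iff (add_nonneg (Nat.cast_nonneg _) x.2.1)]
      have h3 := x.2.1
      have h4 := x.2.2
      constructor <;> linarith
    ext
    · simp only [h1, h2]
    · simp only [h1, h2]; ring
  right_inv := by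
    intro z
    have hk' : (k : ℝ) ≠ 0 := by exact_mod_cast hk.ne'
    ext
    simp only
    field_simp
    ring

lemma glue_coe (k : ℕ) (hk : 0 < k) (p : Fin k × I01) :
    (glue k hk p : ℝ) = ((p.1 : ℕ) + (p.2 : ℝ)) / k := rfl

lemma glue_isIET (k : ℕ) (hk : 0 < k) (σ : Fin k → Fin k) (ψ : Fin k → Equiv.Perm I01)
    (hψ : ∀ i, IsIET (ψ i)) (T : Equiv.Perm I01)
    (hT : ∀ i x, T (glue k hk (i, x)) = glue k hk (σ i, ψ i x)) : IsIET T := by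
  classical
  choose F hF using fun i => (hψ i).exists_good
  have hk' : (0 : ℝ) < k := by exact_mod_cast hk
  let F' : Finset ℝ := (Finset.univ.image (fun i : Fin k => ((i : ℕ) : ℝ) / k)) ∪
    Finset.univ.biUnion (fun i : Fin k => (F i).image (fun f => (((i : ℕ) : ℝ) + f) / k))
  apply GoodF.isIET (F := F')
  intro z w hzw hno
  obtain ⟨⟨i, x⟩, rfl⟩ := (glue k hk).surjective z
  obtain ⟨⟨j, y⟩, rfl⟩ := (glue k hk).surjective w
  simp only [glue_coe] at hzw hno
  rw [div_le_div_iff_of_pos_right hk'] at hzw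
  have hx0 := x.2.1
  have hx1 := x.2.2
  have hy0 := y.2.1
  have hy1 := y.2.2
  have hij : i = j := by
    rcases lt_trichotomy i j with h | h | h
    · exfalso
      have h' : ((i : ℕ) : ℝ) + 1 ≤ (j : ℕ) := by exact_mod_cast h
      refine hno (((j : ℕ) : ℝ) / k) (by simp [F']) ⟨?_, ?_⟩
      · rw [div_lt_div_iff_of_pos_right hk']; linarith
      · rw [div_le_div_iff_of_pos_right hk']; linarith
    · exact h
    · exfalso
      have h' : ((j : ℕ) : ℝ) + 1 ≤ (i : ℕ) := by exact_mod_cast h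
      linarith
  subst hij
  have key := hF i x y (by linarith) (fun f hf hfx => by
    refine hno ((((i : ℕ) : ℝ) + f) / k) ?_ ⟨?_, ?_⟩
    · simp only [F', Finset.mem_union, Finset.mem_biUnion, Finset.mem_univ, true_and]
      exact Or.inr ⟨i, Finset.mem_image_of_mem _ hf⟩
    · rw [div_lt_div_iff_of_pos_right hk']; linarith [hfx.1]
    · rw [div_le_div_iff_of_pos_right hk']; linarith [hfx.2])
  rw [hT, hT]
  simp only [glue_coe]
  rw [← sub_div, ← sub_div]
  congr 1
  linarith

/-- The cocycle of `G` acting on `G ⧸ H` with values in `H`. -/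
noncomputable def cocyc {G : Type*} [Group G] (H : Subgroup G) (g : G) (q : G ⧸ H) : H :=
  ⟨((g • q).out)⁻¹ * (g * q.out), by
    rw [← QuotientGroup.eq, QuotientGroup.out_eq']
    conv_lhs => rw [← QuotientGroup.out_eq' q]
    rfl⟩

lemma cocyc_one {G : Type*} [Group G] (H : Subgroup G) (q : G ⧸ H) : cocyc H 1 q = 1 := by
  ext; simp [cocyc]

lemma cocyc_mul {G : Type*} [Group G] (H : Subgroup G) (g h : G) (q : G ⧸ H) :
    cocyc H (g * h) q = cocyc H g (h • q) * cocyc H h q := by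
  ext; simp [cocyc, mul_smul, mul_assoc]

/-- The induced action of `G` on `G ⧸ H × X`. -/
noncomputable def indHom {G X : Type*} [Group G] (H : Subgroup G) (φ : H →* Equiv.Perm X) :
    G →* Equiv.Perm ((G ⧸ H) × X) :=
  MonoidHom.toHomPerm
    { toFun := fun g p => (g • p.1, φ (cocyc H g p.1) p.2)
      map_one' := by
        funext p
        simp [cocyc_one]
        rfl
      map_mul' := by
        intro g h
        funext p
        change _ = (g • (h • p.1), φ (cocyc H g (h • p.1)) (φ (cocyc H h p.1) p.2))
        simp [cocyc_mul, mul_smul] }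

lemma indHom_apply {G X : Type*} [Group G] (H : Subgroup G) (φ : H →* Equiv.Perm X) (g : G)
    (p : (G ⧸ H) × X) : indHom H φ g p = (g • p.1, φ (cocyc H g p.1) p.2) := rfl

lemma indHom_injective {G X : Type*} [Group G] [Nonempty X] (H : Subgroup G)
    (φ : H →* Equiv.Perm X) (hφ : Function.Injective φ) : Function.Injective (indHom H φ) := by
  rw [injective_iff_map_eq_one]
  intro g hg
  have h : ∀ q x, (g • q, φ (cocyc H g q) x) = ((q, x) : (G ⧸ H) × X) := fun q x => by
    have := congrArg (fun e => e (q, x)) hg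
    simpa [indHom_apply] using this
  let q : G ⧸ H := ((1 : G) : G ⧸ H)
  have h1 : g • q = q := (Prod.ext_iff.1 (h q (Classical.arbitrary X))).1
  have h2 : cocyc H g q = 1 := by
    apply hφ
    ext x
    rw [map_one]
    exact (Prod.ext_iff.1 (h q x)).2
  have h3 := congrArg Subtype.val h2
  simp only [cocyc, h1, Subgroup.coe_one] at h3
  have h4 := inv_mul_eq_one.1 h3
  exact (mul_eq_right.1 h4.symm)

/-- If a finite index subgroup `H` of a group `G` embeds in `IET`, then so does `G`. -/
theorem embeds_in_IET_of_finiteIndex_subgroup_embeds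
    (G : Type*) [Group G] (H : Subgroup G) (hH : H.FiniteIndex)
    (hemb : ∃ φ : ↥H →* Equiv.Perm I01, Function.Injective φ ∧ ∀ h, IsIET (φ h)) :
    ∃ φ : G →* Equiv.Perm I01, Function.Injective φ ∧ ∀ g, IsIET (φ g) := by
  obtain ⟨φ, hφ, hI⟩ := hemb
  have : Finite (G ⧸ H) := inferInstance
  obtain ⟨k, ⟨e⟩⟩ := Finite.exists_equiv_fin (G ⧸ H)
  have hk : 0 < k := Fin.pos (e ((1 : G) : G ⧸ H))
  have : Nonempty I01 := ⟨⟨0, by simp⟩⟩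
  let E : (G ⧸ H) × I01 ≃ I01 := (Equiv.prodCongr e (Equiv.refl _)).trans (glue k hk)
  refine ⟨E.permCongrHom.toMonoidHom.comp (indHom H φ), ?_, fun g => ?_⟩
  · exact E.permCongrHom.injective.comp (indHom_injective H φ hφ)
  · refine glue_isIET k hk (fun i => e (g • e.symm i)) (fun i => φ (cocyc H g (e.symm i)))
      (fun i => hI _) _ (fun i x => ?_)
    have h1 : glue k hk (i, x) = E (e.symm i, x) := by simp [E]
    rw [h1]
    change E (indHom H φ g (E.symm (E (e.symm i, x)))) = _
    rw [Equiv.symm_apply_apply, indHom_apply]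
    simp [E]
end

section
/- For every finite abelian group A and every integer k ≥ 1, the wreath product A ≀ ℤ^k embeds in IET. -/
section Wreath

variable (A B : Type*) [Group A] [Group B]

/-- The subgroup of `B → A` consisting of finitely supported functions; this is the
base group `⊕_{b ∈ B} A` of the restricted wreath product `A ≀ B`. -/
def wreathBase : Subgroup (B → A) where
  carrier := {f | {b | f b ≠ 1}.Finite}
  one_mem' := by simp
  mul_mem' := by
    intro f g hf hg
    refine (hf.union hg).subset ?_
    intro b hb
    by_cases h : f b = 1
    · right
      simp only [Set.mem_setOf_eq, Pi.mul_apply, h, one_mul] at hb ⊢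
      exact hb
    · exact Or.inl h
  inv_mem' := by
    intro f hf
    refine hf.subset ?_
    intro b hb
    simp only [Set.mem_setOf_eq, Pi.inv_apply, ne_eq, inv_eq_one] at hb
    exact hb

/-- The shift action of `B` on the base group `⊕_{b ∈ B} A`, shifting coordinates. -/
def wreathShift : B →* MulAut ↥(wreathBase A B) where
  toFun b :=
    { toFun := fun f => ⟨fun x => f.1 (b⁻¹ * x), by
        refine (f.2.image (fun y => b * y)).subset ?_
        intro x hx
        exact ⟨b⁻¹ * x, hx, by simp⟩⟩
      invFun := fun f => ⟨fun x => f.1 (b * x), by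
        refine (f.2.image (fun y => b⁻¹ * y)).subset ?_
        intro x hx
        exact ⟨b * x, hx, by simp⟩⟩
      left_inv := fun f => by
        apply Subtype.ext
        funext x
        simp
      right_inv := fun f => by
        apply Subtype.ext
        funext x
        simp
      map_mul' := fun f g => rfl }
  map_one' := by
    ext f x
    simp
  map_mul' := fun b c => by
    ext f x
    simp [mul_assoc]

/-- The restricted wreath product `A ≀ B`. -/
abbrev WreathProduct := (↥(wreathBase A B)) ⋊[wreathShift A B] B

end Wreath

open Classical in
theorem isIET_of_floors (T : Equiv.Perm I01) (m : ℝ) (hm : 0 < m) (C : Finset ℝ)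
    (h : ∀ x y : I01, (∀ c ∈ C, ⌊m * (x : ℝ) + c⌋ = ⌊m * (y : ℝ) + c⌋) →
      ((T x : ℝ)) - x = (T y : ℝ) - y) : IsIET T := by
  set S : Finset ℝ := (({0, 1} : Finset ℝ) ∪ C.biUnion (fun c =>
    (Finset.Icc ⌊c⌋ ⌈m + c⌉).image (fun n : ℤ => ((n : ℝ) - c) / m))).filter
      (fun z => 0 ≤ z ∧ z ≤ 1) with hS
  have h0 : (0 : ℝ) ∈ S := by simp [hS]
  have h1 : (1 : ℝ) ∈ S := by simp [hS]
  have hb : ∀ z ∈ S, 0 ≤ z ∧ z ≤ 1 := fun z hz => (Finset.mem_filter.1 hz).2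
  have hcard : S.card = (S.card - 1) + 1 := by
    have := Finset.card_pos.2 ⟨0, h0⟩
    omega
  have hne : S.Nonempty := ⟨0, h0⟩
  refine ⟨S.card - 1, S.orderEmbOfFin hcard, (S.orderEmbOfFin hcard).strictMono, ?_, ?_, ?_⟩
  · have := Finset.orderEmbOfFin_zero hcard (by omega)
    refine Eq.trans this (le_antisymm (Finset.min'_le _ _ h0) ?_)
    exact (hb _ (Finset.min'_mem _ _)).1
  · have := Finset.orderEmbOfFin_last hcard (by omega)
    refine Eq.trans this (le_antisymm ?_ (Finset.le_max' _ _ h1))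
    exact (hb _ (Finset.max'_mem _ _)).2
  · intro i
    set a := S.orderEmbOfFin hcard with ha
    have hmem : ∀ j, a j ∈ S := fun j => Finset.orderEmbOfFin_mem _ _ _
    have hlt : a i.castSucc < a i.succ := a.strictMono (Fin.castSucc_lt_succ)
    have hai : a i.castSucc ∈ I01 :=
      ⟨(hb _ (hmem _)).1, hlt.trans_le (hb _ (hmem _)).2⟩
    refine ⟨(T ⟨a i.castSucc, hai⟩ : ℝ) - a i.castSucc, ?_⟩
    intro x hx
    have := h x ⟨a i.castSucc, hai⟩ ?_
    · simp only at this
      linarith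
    intro c hc
    simp only
    by_contra hne
    have hle : ⌊m * a i.castSucc + c⌋ ≤ ⌊m * (x : ℝ) + c⌋ := by
      apply Int.floor_le_floor
      have := mul_le_mul_of_nonneg_left hx.1 hm.le
      linarith
    have hlt' : ⌊m * a i.castSucc + c⌋ < ⌊m * (x : ℝ) + c⌋ := lt_of_le_of_ne hle (Ne.symm hne)
    set n := ⌊m * (x : ℝ) + c⌋ with hn
    have e1 : m * a i.castSucc + c < n := Int.floor_lt.1 hlt'
    have e2 : (n : ℝ) ≤ m * x + c := Int.floor_le _
    have z1 : a i.castSucc < ((n : ℝ) - c) / m := by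
      rw [lt_div_iff₀ hm]; linarith
    have z2 : ((n : ℝ) - c) / m ≤ x := by
      rw [div_le_iff₀ hm]; linarith
    have hzS : ((n : ℝ) - c) / m ∈ S := by
      rw [hS, Finset.mem_filter]
      refine ⟨?_, hai.1.trans z1.le, z2.trans x.2.2.le⟩
      apply Finset.mem_union_right
      rw [Finset.mem_biUnion]
      refine ⟨c, hc, Finset.mem_image.2 ⟨n, ?_, rfl⟩⟩
      rw [Finset.mem_Icc]
      constructor
      · apply Int.floor_le_floor
        have := mul_nonneg hm.le x.2.1
        linarith
      · have : (n : ℝ) ≤ ⌈m + c⌉ := by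
          refine le_trans ?_ (Int.le_ceil _)
          have := mul_le_mul_of_nonneg_left x.2.2.le hm.le
          linarith
        exact_mod_cast this
    have : ((n : ℝ) - c) / m ∈ Set.range a := by
      rw [ha, Finset.range_orderEmbOfFin]; exact hzS
    obtain ⟨j, hj⟩ := this
    rw [← hj] at z1 z2
    have j1 : i.castSucc < j := a.lt_iff_lt.1 z1
    have j2 : j < i.succ := a.lt_iff_lt.1 (z2.trans_lt hx.2)
    rw [Fin.lt_def] at j1 j2
    simp at j1 j2
    omega

/-- The circle `ℝ / ℤ`. -/
abbrev Circ := AddCircle (1 : ℝ)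

/-- The half circle `[0,1/2)`. -/
def halfC (q : Circ) : Prop := ((AddCircle.equivIco (1 : ℝ) 0 q : ℝ)) < 1 / 2

theorem halfC_coe (y : ℝ) : halfC (y : Circ) ↔ Int.fract y < 1 / 2 := by
  unfold halfC
  rw [AddCircle.coe_equivIco_mk_apply]
  simp

theorem fract_lt_half_iff (y : ℝ) : Int.fract y < 1 / 2 ↔ ⌊y + 1 / 2⌋ = ⌊y⌋ := by
  rw [Int.floor_eq_iff]
  have := Int.floor_add_fract y
  have h0 := Int.fract_nonneg y
  constructor
  · intro h; constructor <;> linarith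
  · rintro ⟨h, h'⟩; linarith

section Construction

variable {A G : Type*} [CommGroup A] [Group G] (α : G → ℝ)

open Classical in
/-- The step function on the circle associated with a finitely supported function. -/
noncomputable def stepF (f : G → A) (q : Circ) : A :=
  ∏ᶠ b : G, if halfC (q - (α b : Circ)) then f b else 1

theorem stepF_mul (f g : wreathBase A G) (q : Circ) :
    stepF α (f.1 * g.1) q = stepF α f.1 q * stepF α g.1 q := by
  unfold stepF
  rw [← finprod_mul_distrib]
  · apply finprod_congr
    intro b
    split_ifs <;> simp
  · refine Set.Finite.subset f.2 ?_
    intro b hb hb'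
    apply hb
    simp [hb']
  · refine Set.Finite.subset g.2 ?_
    intro b hb hb'
    apply hb
    simp [hb']

theorem stepF_one (q : Circ) : stepF α (1 : G → A) q = 1 := by
  unfold stepF
  simp

theorem stepF_shift (hα : ∀ b c, α (b * c) = α b + α c) (b : G) (f : G → A) (q : Circ) :
    stepF α (fun x => f (b⁻¹ * x)) q = stepF α f (q - (α b : Circ)) := by
  unfold stepF
  rw [← finprod_comp_equiv (Equiv.mulLeft b)]
  apply finprod_congr
  intro c
  have e : q - ((α (b * c) : ℝ) : Circ) = q - (α b : Circ) - (α c : Circ) := by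
    rw [hα, AddCircle.coe_add, sub_sub]
  classical
  change (if halfC (q - ((α (b * c) : ℝ) : Circ)) then f (b⁻¹ * (b * c)) else 1) = _
  rw [e, inv_mul_cancel_left]

/-- Fibrewise multiplication. -/
noncomputable def fibHom : wreathBase A G →* Equiv.Perm (Circ × A) :=
  MonoidHom.toHomPerm
    { toFun := fun f p => (p.1, p.2 * stepF α f.1 p.1)
      map_one' := by
        funext p
        have : stepF α ((1 : wreathBase A G) : G → A) p.1 = 1 := stepF_one α p.1
        simp only [this, mul_one]
        rfl
      map_mul' := by
        intro f g
        funext p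
        have : stepF α ((f * g : wreathBase A G) : G → A) p.1 = _ := stepF_mul α f g p.1
        simp only [this]
        change _ = (_, _)
        simp only [mul_assoc, mul_comm (stepF α f.1 p.1)] }

/-- Rotations. -/
noncomputable def rotHom (hα : ∀ b c, α (b * c) = α b + α c) : G →* Equiv.Perm (Circ × A) :=
  MonoidHom.toHomPerm
    { toFun := fun b p => (p.1 + (α b : Circ), p.2)
      map_one' := by
        funext p
        have : α 1 = 0 := by simpa using hα 1 1
        simp only [this]
        simp
        rfl
      map_mul' := by
        intro f g
        funext p
        change _ = (_, _)
        simp only [hα, AddCircle.coe_add]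
        congr 1
        abel }

theorem fibHom_apply (f : wreathBase A G) (p : Circ × A) :
    fibHom α f p = (p.1, p.2 * stepF α f.1 p.1) := rfl

theorem rotHom_apply (hα : ∀ b c, α (b * c) = α b + α c) (b : G) (p : Circ × A) :
    rotHom α hα b p = (p.1 + (α b : Circ), p.2) := rfl

/-- The action of the wreath product on `Circ × A`. -/
noncomputable def wrHom (hα : ∀ b c, α (b * c) = α b + α c) :
    WreathProduct A G →* Equiv.Perm (Circ × A) :=
  SemidirectProduct.lift (fibHom α) (rotHom α hα) (by
    intro b
    ext1 f
    ext1 p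
    have hinv : α b⁻¹ = - α b := by
      have h1 : α 1 = 0 := by simpa using hα 1 1
      have := hα b b⁻¹
      rw [mul_inv_cancel, h1] at this
      linarith
    have hs : stepF α (wreathShift A G b f).1 p.1 = _ := stepF_shift α hα b f.1 p.1
    simp only [MonoidHom.comp_apply, MulEquiv.coe_toMonoidHom, MulAut.conj_apply,
      Equiv.Perm.mul_apply, ← map_inv, fibHom_apply, rotHom_apply, hs, hinv]
    simp [sub_eq_add_neg])

theorem wrHom_apply (hα : ∀ b c, α (b * c) = α b + α c) (g : WreathProduct A G)
    (p : Circ × A) : wrHom α hα g p =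
      (p.1 + (α g.right : Circ), p.2 * stepF α g.left.1 (p.1 + (α g.right : Circ))) := rfl

theorem stepF_injective (hα : ∀ b c, α (b * c) = α b + α c)
    (hi : ∀ b (n : ℤ), 2 * α b = n → b = 1) (f : wreathBase A G)
    (hf : ∀ q, stepF α f.1 q = 1) : f = 1 := by
  have hinv : ∀ b, α b⁻¹ = - α b := by
    intro b
    have h1 : α 1 = 0 := by simpa using hα 1 1
    have := hα b b⁻¹
    rw [mul_inv_cancel, h1] at this
    linarith
  have hd : ∀ b c (n : ℤ), 2 * (α b - α c) = n → b = c := by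
    intro b c n h
    have := hi (b * c⁻¹) n (by rw [hα, hinv, ← h]; ring)
    exact mul_inv_eq_one.1 this
  apply Subtype.ext
  funext b0
  change f.1 b0 = 1
  have hev : ∀ b ∈ {b | f.1 b ≠ 1}, b ≠ b0 → ∀ᶠ ε in nhdsWithin (0 : ℝ) (Set.Ioi 0),
      (halfC (((α b0 - ε : ℝ) : Circ) - (α b : Circ)) ↔
        halfC ((α b0 : Circ) - (α b : Circ))) := by
    intro b _ hne
    set y := α b0 - α b with hy
    have y0 : 0 < Int.fract y := by
      refine lt_of_le_of_ne (Int.fract_nonneg _) ?_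
      intro h
      have := Int.floor_add_fract y
      refine hne (hd b0 b (2 * ⌊y⌋) ?_).symm
      push_cast
      linarith
    have y1 : Int.fract y ≠ 1 / 2 := by
      intro h
      have := Int.floor_add_fract y
      refine hne (hd b0 b (2 * ⌊y⌋ + 1) ?_).symm
      push_cast
      linarith
    have ev1 : ∀ᶠ ε in nhdsWithin (0 : ℝ) (Set.Ioi 0), ε < Int.fract y :=
      mem_nhdsWithin_of_mem_nhds (Iio_mem_nhds y0)
    have ev2 : ∀ᶠ ε in nhdsWithin (0 : ℝ) (Set.Ioi 0), ε < |Int.fract y - 1 / 2| :=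
      mem_nhdsWithin_of_mem_nhds (Iio_mem_nhds (abs_pos.2 (sub_ne_zero.2 y1)))
    filter_upwards [ev1, ev2, self_mem_nhdsWithin] with ε h1 h2 h3
    have h3 : 0 < ε := h3
    rw [← AddCircle.coe_sub, ← AddCircle.coe_sub, halfC_coe, halfC_coe]
    have e : Int.fract (α b0 - ε - α b) = Int.fract y - ε := by
      rw [Int.fract_eq_iff]
      have := Int.floor_add_fract y
      have := Int.fract_lt_one y
      refine ⟨by linarith, by linarith, ⌊y⌋, by linarith⟩
    rw [e, ← hy]
    rcases abs_cases (Int.fract y - 1 / 2) with h | h <;> constructor <;> intro <;> linarith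
  have hev' : ∀ᶠ ε in nhdsWithin (0 : ℝ) (Set.Ioi 0), ∀ b ∈ {b | f.1 b ≠ 1}, b ≠ b0 →
      (halfC (((α b0 - ε : ℝ) : Circ) - (α b : Circ)) ↔
        halfC ((α b0 : Circ) - (α b : Circ))) := by
    rw [Filter.eventually_all_finite f.2]
    intro b hb
    by_cases hne : b = b0
    · simp [hne]
    · filter_upwards [hev b hb hne] with ε h _ using h
  have ev3 : ∀ᶠ ε in nhdsWithin (0 : ℝ) (Set.Ioi 0), ε < 1 / 2 :=
      mem_nhdsWithin_of_mem_nhds (Iio_mem_nhds (by norm_num))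
  obtain ⟨ε, h1, h2, h3⟩ := (hev'.and (ev3.and self_mem_nhdsWithin)).exists
  have h3 : 0 < ε := h3
  classical
  have key : stepF α f.1 (α b0 : Circ) = stepF α f.1 ((α b0 - ε : ℝ) : Circ) * f.1 b0 := by
    have hsingle : f.1 b0 = ∏ᶠ b : G, if b = b0 then f.1 b else 1 := by
      rw [finprod_eq_single _ b0]
      · simp
      · intro b hb
        simp [hb]
    unfold stepF
    rw [hsingle, ← finprod_mul_distrib]
    · apply finprod_congr
      intro b
      by_cases hb : b = b0
      · subst hb
        have e1 : halfC ((α b : Circ) - (α b : Circ)) := by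
          rw [← AddCircle.coe_sub, halfC_coe]
          simp
        have e2 : ¬ halfC (((α b - ε : ℝ) : Circ) - (α b : Circ)) := by
          rw [← AddCircle.coe_sub, halfC_coe]
          have : Int.fract (α b - ε - α b) = 1 - ε := by
            rw [Int.fract_eq_iff]
            refine ⟨by linarith, by linarith, -1, by push_cast; ring⟩
          rw [this]
          linarith
        rw [if_pos e1, if_neg e2]
        simp
      · by_cases hfb : f.1 b = 1
        · simp [hfb]
        · have := h1 b hfb hb
          simp only [this, if_neg hb, mul_one]
    · refine Set.Finite.subset f.2 ?_
      intro b hb hb'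
      apply hb
      simp [hb']
    · refine Set.Finite.subset f.2 ?_
      intro b hb hb'
      apply hb
      simp [hb']
  rw [hf, hf, one_mul] at key
  exact key.symm

theorem stepF_congr (f : wreathBase A G) (x y : ℝ)
    (h : ∀ b ∈ {b | f.1 b ≠ 1}, ⌊x - α b⌋ = ⌊y - α b⌋ ∧
      ⌊x - α b + 1 / 2⌋ = ⌊y - α b + 1 / 2⌋) :
    stepF α f.1 (x : Circ) = stepF α f.1 (y : Circ) := by
  classical
  unfold stepF
  apply finprod_congr
  intro b
  by_cases hfb : f.1 b = 1
  · simp [hfb]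
  · obtain ⟨h1, h2⟩ := h b hfb
    simp only [← AddCircle.coe_sub, halfC_coe, fract_lt_half_iff, h1, h2]

/-- Cutting `[0,1)` into `m` circles. -/
noncomputable def cutEquiv (m : ℕ) (hm : 0 < m) (e : Fin m ≃ A) : I01 ≃ Circ × A where
  toFun z := (((m * (z : ℝ) : ℝ) : Circ), e ⟨⌊(m : ℝ) * z⌋₊, by
    rw [Nat.floor_lt (mul_nonneg (Nat.cast_nonneg _) z.2.1)]
    have : (0 : ℝ) < m := by exact_mod_cast hm
    nlinarith [z.2.2]⟩)
  invFun p := ⟨(((e.symm p.2 : ℕ) : ℝ) + (AddCircle.equivIco (1 : ℝ) 0 p.1 : ℝ)) / m, by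
    have hm' : (0 : ℝ) < m := by exact_mod_cast hm
    have h1 := (AddCircle.equivIco (1 : ℝ) 0 p.1).2
    have h2 : ((e.symm p.2 : ℕ) : ℝ) + 1 ≤ m := by exact_mod_cast (e.symm p.2).2
    have h3 : (0 : ℝ) ≤ ((e.symm p.2 : ℕ) : ℝ) := Nat.cast_nonneg _
    constructor
    · exact div_nonneg (add_nonneg h3 h1.1) hm'.le
    · rw [div_lt_one hm']
      have := h1.2
      linarith⟩
  left_inv z := by
    have hm' : (0 : ℝ) < m := by exact_mod_cast hm
    apply Subtype.ext
    simp only [Equiv.symm_apply_apply, AddCircle.coe_equivIco_mk_apply, div_one, mul_one]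
    rw [natCast_floor_eq_intCast_floor (mul_nonneg hm'.le z.2.1), Int.floor_add_fract]
    field_simp
  right_inv p := by
    have hm' : (0 : ℝ) < m := by exact_mod_cast hm
    have h1 := (AddCircle.equivIco (1 : ℝ) 0 p.1).2
    have hc : (m : ℝ) * ((((e.symm p.2 : ℕ) : ℝ) +
        (AddCircle.equivIco (1 : ℝ) 0 p.1 : ℝ)) / m) = ((e.symm p.2 : ℕ) : ℝ) +
        (AddCircle.equivIco (1 : ℝ) 0 p.1 : ℝ) := by field_simp
    apply Prod.ext
    · simp only [hc]
      have hq : (((AddCircle.equivIco (1 : ℝ) 0 p.1 : ℝ)) : Circ) = p.1 :=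
        (AddCircle.equivIco (1 : ℝ) 0).symm_apply_apply p.1
      have hn : ((((e.symm p.2 : ℕ) : ℝ)) : Circ) = 0 := by
        rw [AddCircle.coe_eq_zero_iff]
        exact ⟨((e.symm p.2 : ℕ) : ℤ), by simp⟩
      rw [AddCircle.coe_add, hq, hn, zero_add]
    · simp only [hc]
      rw [← e.eq_symm_apply]
      apply Fin.ext
      simp only
      rw [Nat.floor_eq_iff (add_nonneg (Nat.cast_nonneg _) h1.1)]
      have h2 := h1.1
      have h3 := h1.2
      constructor <;> linarith

theorem embeds_of_rotation [Finite A] (hα : ∀ b c, α (b * c) = α b + α c)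
    (hi : ∀ b (n : ℤ), 2 * α b = n → b = 1) :
    ∃ φ : WreathProduct A G →* Equiv.Perm I01,
      Function.Injective φ ∧ ∀ g, IsIET (φ g) := by
  classical
  obtain ⟨m, ⟨e'⟩⟩ := Finite.exists_equiv_fin A
  have hm : 0 < m := lt_of_le_of_lt (Nat.zero_le _) (e' 1).2
  have hm' : (0 : ℝ) < m := by exact_mod_cast hm
  set e := e'.symm
  set E := cutEquiv m hm e with hE
  refine ⟨(E.symm.permCongrHom.toMonoidHom).comp (wrHom α hα), ?_, ?_⟩
  · apply Function.Injective.comp (E.symm.permCongrHom.injective)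
    rw [injective_iff_map_eq_one]
    intro g hg
    have h1 : ∀ p : Circ × A, (p.1 + (α g.right : Circ),
        p.2 * stepF α g.left.1 (p.1 + (α g.right : Circ))) = p := by
      intro p
      rw [← wrHom_apply α hα, hg]
      rfl
    have hr : g.right = 1 := by
      have := congrArg Prod.fst (h1 (0, 1))
      simp only [zero_add] at this
      rw [AddCircle.coe_eq_zero_iff] at this
      obtain ⟨n, hn⟩ := this
      apply hi _ (2 * n)
      rw [← hn]
      simp
    have hl : g.left = 1 := by
      apply stepF_injective α hα hi
      intro q
      have := congrArg Prod.snd (h1 (q - (α g.right : Circ), 1))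
      simpa using this
    exact SemidirectProduct.ext hl hr
  · intro g
    have hfin : {b | g.left.1 b ≠ 1}.Finite := g.left.2
    set S := hfin.toFinset with hS
    set C : Finset ℝ := {0, α g.right} ∪ S.image (fun b => α g.right - α b) ∪
      S.image (fun b => α g.right - α b + 1 / 2) with hC
    apply isIET_of_floors _ m hm' C
    have hT : ∀ x : I01, (((E.symm.permCongrHom.toMonoidHom).comp (wrHom α hα) g) x : ℝ) =
        (((e.symm (e ⟨⌊(m : ℝ) * x⌋₊, by
            rw [Nat.floor_lt (mul_nonneg (Nat.cast_nonneg _) x.2.1)]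
            nlinarith [x.2.2]⟩ *
          stepF α g.left.1 ((m * (x : ℝ) + α g.right : ℝ) : Circ)) : ℕ) : ℝ) +
            Int.fract (m * (x : ℝ) + α g.right)) / m := by
      intro x
      have h0 : Int.fract (m * (x : ℝ) + α g.right) =
        (AddCircle.equivIco (1 : ℝ) 0 ((m * (x : ℝ) + α g.right : ℝ) : Circ) : ℝ) := by
        rw [AddCircle.coe_equivIco_mk_apply]
        simp
      rw [h0]
      rfl
    intro x y hxy
    have hx0 : ⌊(m : ℝ) * x⌋ = ⌊(m : ℝ) * y⌋ := by
      simpa using hxy 0 (by simp [hC])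
    have hx1 := hxy (α g.right) (by simp [hC])
    have hx0' : ⌊(m : ℝ) * x⌋₊ = ⌊(m : ℝ) * y⌋₊ := by
      rw [← Int.floor_toNat, ← Int.floor_toNat, hx0]
    have hst : stepF α g.left.1 ((m * (x : ℝ) + α g.right : ℝ) : Circ) =
        stepF α g.left.1 ((m * (y : ℝ) + α g.right : ℝ) : Circ) := by
      apply stepF_congr
      intro b hb
      have hbS : b ∈ S := by rw [hS, Set.Finite.mem_toFinset]; exact hb
      have a1 := hxy (α g.right - α b) (by
        rw [hC]
        exact Finset.mem_union_left _ (Finset.mem_union_right _ (Finset.mem_image_of_mem _ hbS)))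
      have a2 := hxy (α g.right - α b + 1 / 2) (by
        rw [hC]
        exact Finset.mem_union_right _ (Finset.mem_image_of_mem
          (fun b => α g.right - α b + 1 / 2) hbS))
      simp only [add_sub_assoc, add_assoc] at a1 a2 ⊢
      exact ⟨a1, a2⟩
    rw [hT, hT]
    simp only [hx0', hst]
    have f1 := Int.floor_add_fract (m * (x : ℝ) + α g.right)
    have f2 := Int.floor_add_fract (m * (y : ℝ) + α g.right)
    rw [hx1] at f1
    field_simp
    linarith

end Construction

theorem exists_rotation (k : ℕ) : ∃ α : Multiplicative (Fin k → ℤ) → ℝ,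
    (∀ b c, α (b * c) = α b + α c) ∧ ∀ b (n : ℤ), 2 * α b = n → b = 1 := by
  obtain ⟨t, ht⟩ : ∃ t : ℝ, Transcendental ℤ t :=
    ⟨_, transcendental_liouvilleNumber (m := 2) le_rfl⟩
  refine ⟨fun b => ∑ i : Fin k, ((Multiplicative.toAdd b i : ℤ) : ℝ) * t ^ ((i : ℕ) + 1), ?_, ?_⟩
  · intro b c
    rw [← Finset.sum_add_distrib]
    apply Finset.sum_congr rfl
    intro i _
    simp [add_mul]
  · intro b n h
    set P : Polynomial ℤ := (∑ i : Fin k, Polynomial.monomial ((i : ℕ) + 1)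
      (2 * Multiplicative.toAdd b i)) - Polynomial.C n with hP
    have hP0 : P = 0 := by
      apply (transcendental_iff.1 ht) P
      rw [hP]
      simp only [map_sub, map_sum, Polynomial.aeval_monomial, Polynomial.aeval_C]
      rw [sub_eq_zero]
      simp only [algebraMap_int_eq, eq_intCast]
      rw [← h, Finset.mul_sum]
      apply Finset.sum_congr rfl
      intro i _
      push_cast
      ring
    apply Multiplicative.toAdd.injective
    funext j
    have hc := congrArg (fun p => Polynomial.coeff p ((j : ℕ) + 1)) hP0
    simp only [hP, Polynomial.coeff_sub, Polynomial.finsetSum_coeff, Polynomial.coeff_monomial,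
      Polynomial.coeff_C_succ, Polynomial.coeff_zero, sub_zero] at hc
    rw [Finset.sum_eq_single j] at hc
    · simp at hc
      simpa using hc
    · intro i _ hij
      rw [if_neg]
      intro hh
      apply hij
      apply Fin.ext
      omega
    · simp

/-- For every finite abelian group `A` and every `k ≥ 1`, the wreath product `A ≀ ℤ^k`
embeds in `IET`. -/
theorem wreath_abelian_by_Zk_embeds_in_IET
    (A : Type*) [CommGroup A] [Finite A] (k : ℕ) (hk : 1 ≤ k) :
    ∃ φ : WreathProduct A (Multiplicative (Fin k → ℤ)) →* Equiv.Perm I01,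
      Function.Injective φ ∧ ∀ g, IsIET (φ g) := by
  obtain ⟨α, hα, hi⟩ := exists_rotation k
  exact embeds_of_rotation α hα hi
end

section
/- Let F be a finite group. If the wreath product F ≀ ℤ embeds in IET (i.e. there exists an injective group homomorphism F ≀ ℤ → IET), then F is abelian. -/
namespace IETWreath
open MeasureTheory

lemma exists_piece {n : ℕ} (a : Fin (n + 1) → ℝ) (h0 : a 0 = 0) (h1 : a (Fin.last n) = 1)
    (x : I01) : ∃ i : Fin n, (x : ℝ) ∈ Set.Ico (a i.castSucc) (a i.succ) := by
  by_contra hcon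
  push Not at hcon
  have h : ∀ i : Fin (n + 1), a i ≤ x := by
    intro i
    induction i using Fin.induction with
    | zero => rw [h0]; exact x.2.1
    | succ i ih =>
      by_contra hlt
      exact hcon i ⟨ih, not_le.mp hlt⟩
  have := h (Fin.last n)
  rw [h1] at this
  exact absurd x.2.2 (not_lt.mpr this)

lemma iet_displ {T : Equiv.Perm I01} (hT : IsIET T) :
    ∃ D : Finset ℝ, ∀ x : I01, (T x : ℝ) - x ∈ D := by
  obtain ⟨n, a, -, h0, h1, h⟩ := hT
  choose c hc using h
  refine ⟨Finset.univ.image c, fun x => ?_⟩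
  obtain ⟨i, hi⟩ := exists_piece a h0 h1 x
  rw [hc i x hi]
  simp

lemma iet_measurable {T : Equiv.Perm I01} (hT : IsIET T) : Measurable T := by
  obtain ⟨n, a, -, h0, h1, h⟩ := hT
  choose c hc using h
  refine Measurable.subtype_mk (f := fun x => (T x : ℝ)) ?_ (h := fun x => (T x).2)
  intro B hB
  have : (fun x => (T x : ℝ)) ⁻¹' B = ⋃ i : Fin n,
      {x : I01 | (x : ℝ) ∈ Set.Ico (a i.castSucc) (a i.succ)} ∩ {x : I01 | (x : ℝ) + c i ∈ B} := by
    ext x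
    simp only [Set.mem_preimage, Set.mem_iUnion, Set.mem_inter_iff, Set.mem_setOf_eq]
    constructor
    · intro hx
      obtain ⟨i, hi⟩ := exists_piece a h0 h1 x
      exact ⟨i, hi, by rw [← hc i x hi]; exact hx⟩
    · rintro ⟨i, hi, hx⟩
      rw [hc i x hi]; exact hx
  rw [this]
  refine MeasurableSet.iUnion fun i => MeasurableSet.inter ?_ ?_
  · exact measurable_subtype_coe measurableSet_Ico
  · exact (measurable_subtype_coe.add_const (c i)) hB

noncomputable instance : MeasureSpace I01 := ⟨Measure.comap (fun x : I01 => (x : ℝ)) volume⟩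

lemma vol_sub (A : Set I01) : volume A = volume ((fun x : I01 => (x : ℝ)) '' A) :=
  (MeasurableEmbedding.subtype_coe (measurableSet_Ico)).comap_apply volume A

lemma iet_image_le {T : Equiv.Perm I01} (hT : IsIET T) (A : Set I01) (hA : MeasurableSet A) :
    volume (T '' A) ≤ volume A := by
  obtain ⟨n, a, ha, h0, h1, h⟩ := hT
  choose c hc using h
  have hmA : MeasurableSet ((fun x : I01 => (x : ℝ)) '' A) :=
    (MeasurableEmbedding.subtype_coe (measurableSet_Ico)).measurableSet_image.mpr hA
  rw [vol_sub, vol_sub A]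
  set B : Set ℝ := (fun x : I01 => (x : ℝ)) '' A with hB
  let P : Fin n → Set ℝ := fun i => B ∩ Set.Ico (a i.castSucc) (a i.succ)
  have hsub : (fun x : I01 => (x : ℝ)) '' (T '' A) ⊆ ⋃ i : Fin n, (fun y => y + c i) '' P i := by
    rintro _ ⟨_, ⟨x, hx, rfl⟩, rfl⟩
    obtain ⟨i, hi⟩ := exists_piece a h0 h1 x
    exact Set.mem_iUnion.mpr ⟨i, x, ⟨⟨x, hx, rfl⟩, hi⟩, (hc i x hi).symm⟩
  have hdisj : Pairwise (Function.onFun Disjoint P) := by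
    have key : ∀ i j : Fin n, i < j → Disjoint (P i) (P j) := by
      intro i j hij
      rw [Set.disjoint_left]
      rintro y ⟨-, hy1⟩ ⟨-, hy2⟩
      have : a i.succ ≤ a j.castSucc := ha.monotone (by
        rw [Fin.le_def]; simp; exact hij)
      exact absurd (hy1.2.trans_le this) (not_lt.mpr hy2.1)
    intro i j hij
    rcases lt_or_gt_of_ne hij with h | h
    · exact key i j h
    · exact (key j i h).symm
  calc volume ((fun x : I01 => (x : ℝ)) '' (T '' A))
      ≤ volume (⋃ i : Fin n, (fun y => y + c i) '' P i) := measure_mono hsub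
    _ ≤ ∑' i : Fin n, volume ((fun y => y + c i) '' P i) := measure_iUnion_le _
    _ = ∑' i : Fin n, volume (P i) := by
        congr 1; ext i
        simp
    _ = volume (⋃ i, P i) := (measure_iUnion hdisj fun i => hmA.inter measurableSet_Ico).symm
    _ ≤ volume B := measure_mono (Set.iUnion_subset fun i => Set.inter_subset_left)

lemma iet_preimage_ge {T : Equiv.Perm I01} (hT : IsIET T) (A : Set I01) (hA : MeasurableSet A) :
    volume A ≤ volume (T ⁻¹' A) := by
  have := iet_image_le hT (T ⁻¹' A) (iet_measurable hT hA)
  rwa [Set.image_preimage_eq A T.surjective] at this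

lemma iet_supp_pos {T : Equiv.Perm I01} (hT : IsIET T) (hne : T ≠ 1) :
    0 < volume {x | T x ≠ x} := by
  obtain ⟨n, a, ha, h0, h1, h⟩ := hT
  have : ∃ y, T y ≠ y := by
    by_contra hcon
    push Not at hcon
    exact hne (Equiv.ext hcon)
  obtain ⟨y, hy⟩ := this
  obtain ⟨i, hi⟩ := exists_piece a h0 h1 y
  obtain ⟨c, hc⟩ := h i
  have hc0 : c ≠ 0 := by
    rintro rfl
    apply hy
    apply Subtype.ext
    rw [hc y hi, add_zero]
  rw [vol_sub]
  have hsub : Set.Ico (y : ℝ) (a i.succ) ⊆ (fun x : I01 => (x : ℝ)) '' {x | T x ≠ x} := by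
    intro z hz
    have hz1 : a i.succ ≤ 1 := by rw [← h1]; exact ha.monotone (Fin.le_last _)
    refine ⟨⟨z, y.2.1.trans hz.1, hz.2.trans_le hz1⟩, ?_, rfl⟩
    intro heq
    have h2 := hc ⟨z, y.2.1.trans hz.1, hz.2.trans_le hz1⟩ ⟨hi.1.trans hz.1, hz.2⟩
    rw [heq] at h2
    apply hc0
    simpa using h2
  refine lt_of_lt_of_le ?_ (measure_mono hsub)
  rw [Real.volume_Ico]
  simpa using hi.2

lemma iet_measSupp {T : Equiv.Perm I01} (hT : IsIET T) : MeasurableSet {x | T x ≠ x} :=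
  (measurableSet_eq_fun (iet_measurable hT) measurable_id).compl

instance : IsProbabilityMeasure (volume : Measure I01) := ⟨by
  rw [vol_sub, Set.image_univ, Subtype.range_coe, Real.volume_Ico]; simp⟩

/-- Averaging. -/
lemma exists_many (E : ℕ → Set I01) (hE : ∀ j, MeasurableSet (E j)) (δ : ENNReal)
    (hδ : ∀ j, δ ≤ volume (E j)) (q m : ℕ) (hm : 0 < m) (hq : (q : ENNReal)⁻¹ < δ) (hq0 : 0 < q) :
    ∃ (x : I01) (B : Finset ℕ), B ⊆ Finset.range (q * m) ∧ (∀ j ∈ B, x ∈ E j) ∧ m ≤ B.card := by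
  classical
  by_contra hcon
  push Not at hcon
  have hle : ∀ x, ∑ j ∈ Finset.range (q * m), (E j).indicator (1 : I01 → ENNReal) x ≤ m := by
    intro x
    have := hcon x ((Finset.range (q * m)).filter (fun j => x ∈ E j)) (Finset.filter_subset _ _)
      (by intro j hj; exact (Finset.mem_filter.mp hj).2)
    simp only [Set.indicator_apply, Pi.one_apply]
    rw [Finset.sum_boole]
    exact_mod_cast this.le
  have h1 : ∑ j ∈ Finset.range (q * m), volume (E j) ≤ m := by
    calc ∑ j ∈ Finset.range (q * m), volume (E j)
        = ∑ j ∈ Finset.range (q * m), ∫⁻ x, (E j).indicator (1 : I01 → ENNReal) x := by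
          refine Finset.sum_congr rfl fun j _ => ?_
          rw [lintegral_indicator_one (hE j)]
      _ = ∫⁻ x, ∑ j ∈ Finset.range (q * m), (E j).indicator (1 : I01 → ENNReal) x := by
          rw [lintegral_finsetSum]
          intro j _
          exact measurable_one.indicator (hE j)
      _ ≤ ∫⁻ _ : I01, (m : ENNReal) := lintegral_mono hle
      _ = m := by simp
  have h2 : ((q * m : ℕ) : ENNReal) * δ ≤ m := by
    refine le_trans ?_ h1
    have := Finset.card_nsmul_le_sum (Finset.range (q * m)) (fun j => volume (E j)) δ
      (fun j _ => hδ j)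
    simpa using this
  have h3 : (m : ENNReal) < ((q * m : ℕ) : ENNReal) * δ := by
    have hne : ((q * m : ℕ) : ENNReal) ≠ 0 := by
      exact_mod_cast (Nat.mul_pos hq0 hm).ne'
    calc (m : ENNReal) = ((q * m : ℕ) : ENNReal) * (q : ENNReal)⁻¹ := by
          push_cast
          rw [mul_comm (q : ENNReal), mul_assoc, ENNReal.mul_inv_cancel, mul_one]
          · exact_mod_cast hq0.ne'
          · exact ENNReal.natCast_ne_top q
      _ < _ := (ENNReal.mul_lt_mul_iff_right hne (ENNReal.natCast_ne_top _)).mpr hq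
  exact absurd h2 (not_le.mpr h3)

end IETWreath

namespace IETWreath

/-- `r` is a sum of at most ... elements of `D`, each used at most `N` times. -/
def IsComb (D : Finset ℝ) (N : ℕ) (r : ℝ) : Prop :=
  ∃ k : D → Fin (N + 1), r = ∑ d : D, (k d : ℕ) * (d : ℝ)

lemma isComb_zero (D : Finset ℝ) : IsComb D 0 0 := ⟨fun _ => 0, by simp⟩

lemma isComb_add {D : Finset ℝ} {N : ℕ} {r d : ℝ} (h : IsComb D N r) (hd : d ∈ D) :
    IsComb D (N + 1) (d + r) := by
  classical
  obtain ⟨k, rfl⟩ := h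
  refine ⟨fun e => if e = ⟨d, hd⟩ then (k e).succ else (k e).castSucc, ?_⟩
  have : ∀ e : D, (((if e = ⟨d, hd⟩ then (k e).succ else (k e).castSucc : Fin (N + 2)) : ℕ) : ℝ)
      * (e : ℝ) = (if e = ⟨d, hd⟩ then (e : ℝ) else 0) + (k e : ℕ) * (e : ℝ) := by
    intro e
    split_ifs
    · simp; ring
    · simp
  rw [Finset.sum_congr rfl fun e _ => this e, Finset.sum_add_distrib]
  simp

lemma comb_finset (D : Finset ℝ) (N : ℕ) :
    ∃ Z : Finset ℝ, Z.card ≤ (N + 1) ^ D.card ∧ ∀ r, IsComb D N r → r ∈ Z := by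
  classical
  refine ⟨Finset.univ.image (fun k : D → Fin (N + 1) => ∑ d : D, (k d : ℕ) * (d : ℝ)), ?_, ?_⟩
  · refine Finset.card_image_le.trans ?_
    simp
  · rintro r ⟨k, rfl⟩
    exact Finset.mem_image_of_mem _ (Finset.mem_univ k)

/-- One-sided counting. -/
lemma bad_count {F : Type*} [Group F] (S : Subgroup (ℕ → F)) (n : ℕ)
    (v : (ℕ → F) → ℝ) (Z : Finset ℝ) (hvZ : ∀ f, v f ∈ Z) (hv : ∀ f g, v f = v g → f⁻¹ * g ∈ S)
    (ρ : ℕ → ℕ) (hρ : ∀ i < n, ∀ j < n, ρ i = ρ j → i = j)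
    (B : Finset ℕ) (hB : B ⊆ Finset.range n)
    (hbad : ∀ j ∈ B, ¬ ∀ a : F, ∃ s ∈ S, s j = a ∧ ∀ i < n, ρ i < ρ j → s i = 1) :
    2 ^ B.card ≤ Z.card := by
  classical
  push Not at hbad
  have hbad' : ∀ j, ∃ a : F, j ∈ B → ∀ s ∈ S, s j = a → ∃ i < n, ρ i < ρ j ∧ s i ≠ 1 := by
    intro j
    by_cases hj : j ∈ B
    · obtain ⟨a, ha⟩ := hbad j hj
      exact ⟨a, fun _ => ha⟩
    · exact ⟨1, fun h => absurd h hj⟩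
  choose b hb using hbad'
  let f : Finset ℕ → (ℕ → F) := fun E j => if j ∈ E then b j else 1
  rw [← Finset.card_powerset]
  refine Finset.card_le_card_of_injOn (fun E => v (f E)) (fun E _ => hvZ _) ?_
  intro E hE E' hE' heq
  simp only [Finset.coe_powerset, Set.mem_preimage, Set.mem_powerset_iff, Finset.coe_subset]
    at hE hE'
  by_contra hne
  have hnon : (symmDiff E E').Nonempty := by
    rw [Finset.nonempty_iff_ne_empty]
    intro h
    exact hne (symmDiff_eq_bot.mp h)
  obtain ⟨j, hj, hmin⟩ := Finset.exists_min_image _ ρ hnon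
  have hsub : ∀ i, i < n → ρ i < ρ j → f E i = f E' i := by
    intro i _ hij
    have : i ∉ symmDiff E E' := fun h => absurd (hmin i h) (not_le.mpr hij)
    simp only [Finset.mem_symmDiff] at this
    simp only [f]
    have h2 : i ∈ E ↔ i ∈ E' := by tauto
    simp [h2]
  have key : ∀ E E' : Finset ℕ, E ⊆ B → v (f E) = v (f E') → j ∈ E → j ∉ E' →
      (∀ i, i < n → ρ i < ρ j → f E i = f E' i) → False := by
    intro E E' hEB heq h1 h2 hs
    have hS := hv _ _ heq.symm
    obtain ⟨i, hin, hij, hi⟩ := hb j (hEB h1) _ hS (by simp [f, h1, h2])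
    apply hi
    simp [hs i hin hij]
  rcases Finset.mem_symmDiff.mp hj with ⟨h1, h2⟩ | ⟨h1, h2⟩
  · exact key E E' hE heq h1 h2 hsub
  · exact key E' E hE' heq.symm h1 h2 (fun i h h' => (hsub i h h').symm)

lemma bad_count_two {F : Type*} [Group F] (S : Subgroup (ℕ → F)) (n : ℕ)
    (hSn : ∀ f g : ℕ → F, (∀ i < n, f i = g i) → f ∈ S → g ∈ S)
    (v : (ℕ → F) → ℝ) (Z : Finset ℝ) (hvZ : ∀ f, v f ∈ Z) (hv : ∀ f g, v f = v g → f⁻¹ * g ∈ S)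
    (a b : F) (B : Finset ℕ) (hB : B ⊆ Finset.range n)
    (hbad : ∀ j ∈ B, Pi.mulSingle j (a * b * a⁻¹ * b⁻¹) ∉ S) :
    2 ^ B.card ≤ Z.card ^ 2 := by
  classical
  let P : (ℕ → ℕ) → ℕ → Prop := fun ρ j =>
    ∀ a : F, ∃ s ∈ S, s j = a ∧ ∀ i < n, ρ i < ρ j → s i = 1
  let ρ₁ : ℕ → ℕ := fun i => i
  let ρ₂ : ℕ → ℕ := fun i => n - i
  have h1 : 2 ^ (B.filter fun j => ¬ P ρ₁ j).card ≤ Z.card :=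
    bad_count S n v Z hvZ hv ρ₁ (fun i _ j _ h => h) _ ((Finset.filter_subset _ _).trans hB)
      (fun j hj => (Finset.mem_filter.mp hj).2)
  have h2 : 2 ^ (B.filter fun j => ¬ P ρ₂ j).card ≤ Z.card :=
    bad_count S n v Z hvZ hv ρ₂ (fun i _ j _ h => by simp only [ρ₂] at h; omega) _
      ((Finset.filter_subset _ _).trans hB)
      (fun j hj => (Finset.mem_filter.mp hj).2)
  have h3 : B ⊆ (B.filter fun j => ¬ P ρ₁ j) ∪ (B.filter fun j => ¬ P ρ₂ j) := by
    intro j hj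
    rw [Finset.mem_union, Finset.mem_filter, Finset.mem_filter]
    by_contra hcon
    have p1 : P ρ₁ j := by tauto
    have p2 : P ρ₂ j := by tauto
    obtain ⟨s, hs, hsj, hs1⟩ := p1 a
    obtain ⟨u, hu, huj, hu1⟩ := p2 b
    apply hbad j hj
    refine hSn (s * u * s⁻¹ * u⁻¹) _ ?_
      (S.mul_mem (S.mul_mem (S.mul_mem hs hu) (S.inv_mem hs)) (S.inv_mem hu))
    intro i hi
    rcases lt_trichotomy i j with h | h | h
    · rw [Pi.mulSingle_eq_of_ne h.ne]
      simp [hs1 i hi h]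
    · subst h
      simp [hsj, huj]
    · rw [Pi.mulSingle_eq_of_ne h.ne']
      have : ρ₂ i < ρ₂ j := by simp only [ρ₂]; omega
      simp [hu1 i hi this]
  calc 2 ^ B.card ≤ 2 ^ ((B.filter fun j => ¬ P ρ₁ j).card + (B.filter fun j => ¬ P ρ₂ j).card) :=
        Nat.pow_le_pow_right (by norm_num)
          ((Finset.card_le_card h3).trans (Finset.card_union_le _ _))
    _ ≤ Z.card ^ 2 := by
        rw [pow_add, sq]; exact Nat.mul_le_mul h1 h2

lemma growth_contra (C k : ℕ) (h : ∀ m : ℕ, 0 < m → 2 ^ m ≤ (C * m + 1) ^ k) : False := by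
  have ht := tendsto_pow_const_div_const_pow_of_one_lt k (r := (2 : ℝ)) (by norm_num)
  have hpos : (0 : ℝ) < (((C : ℝ) + 1) ^ k)⁻¹ := by positivity
  have hev := (ht.eventually (gt_mem_nhds hpos)).and (Filter.eventually_gt_atTop 0)
  obtain ⟨m, hm, hm0⟩ := hev.exists
  have h1 := h m hm0
  have h2 : ((2 : ℝ)) ^ m ≤ (C * m + 1) ^ k := by exact_mod_cast h1
  have h3 : ((C : ℝ) * m + 1) ^ k ≤ (((C : ℝ) + 1) ^ k) * (m : ℝ) ^ k := by
    rw [← mul_pow]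
    have : (1 : ℝ) ≤ m := by exact_mod_cast hm0
    gcongr
    linarith
  rw [div_lt_iff₀ (by positivity), inv_mul_eq_div, lt_div_iff₀ (by positivity)] at hm
  linarith

section W
variable (F : Type*) [Group F]

/-- Finitely supported element attached to `f` truncated to `[0,n)`. -/
def trunc (n : ℕ) : (ℕ → F) →* ↥(wreathBase F (Multiplicative ℤ)) where
  toFun f := ⟨fun z => if 0 ≤ z.toAdd ∧ z.toAdd < n then f z.toAdd.toNat else 1, by
    refine ((Set.finite_Ico (0 : ℤ) n).image Multiplicative.ofAdd).subset ?_
    intro z hz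
    refine ⟨z.toAdd, ?_, rfl⟩
    by_contra hcon
    apply hz
    exact if_neg hcon⟩
  map_one' := by
    apply Subtype.ext
    funext z
    simp
  map_mul' f g := by
    apply Subtype.ext
    funext z
    change (if 0 ≤ z.toAdd ∧ z.toAdd < (n : ℤ) then f z.toAdd.toNat * g z.toAdd.toNat else 1) =
      (if 0 ≤ z.toAdd ∧ z.toAdd < (n : ℤ) then f z.toAdd.toNat else 1) *
      (if 0 ≤ z.toAdd ∧ z.toAdd < (n : ℤ) then g z.toAdd.toNat else 1)
    split_ifs with h
    · rfl
    · simp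

/-- The generator of `ℤ`. -/
def tt : WreathProduct F (Multiplicative ℤ) := SemidirectProduct.inr (Multiplicative.ofAdd 1)

/-- The lamp at zero. -/
def lamp (a : F) : WreathProduct F (Multiplicative ℤ) :=
  SemidirectProduct.inl (trunc F 1 (fun _ => a))

lemma tt_pow (n : ℕ) : tt F ^ n = SemidirectProduct.inr (Multiplicative.ofAdd (n : ℤ)) := by
  rw [tt, ← map_pow, ← ofAdd_nsmul]; simp

lemma conj_lamp (a : F) (n : ℕ) (z : Multiplicative ℤ) :
    ∃ w : ↥(wreathBase F (Multiplicative ℤ)),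
      tt F ^ n * lamp F a * (tt F ^ n)⁻¹ = SemidirectProduct.inl w ∧
      ∀ z : Multiplicative ℤ, w.1 z = if z.toAdd = n then a else 1 := by
  refine ⟨wreathShift F (Multiplicative ℤ) (Multiplicative.ofAdd (n : ℤ))
    (trunc F 1 (fun _ => a)), ?_, ?_⟩
  · rw [SemidirectProduct.inl_aut, tt_pow, lamp, map_inv]
  · intro z
    change (if 0 ≤ ((Multiplicative.ofAdd (n : ℤ))⁻¹ * z).toAdd ∧ _ < ((1 : ℕ) : ℤ) then a else 1) = _
    refine if_congr ?_ rfl rfl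
    simp only [toAdd_mul, toAdd_inv, toAdd_ofAdd]
    push_cast
    omega

lemma trunc_succ (f : ℕ → F) (n : ℕ) :
    (SemidirectProduct.inl (trunc F (n + 1) f) : WreathProduct F (Multiplicative ℤ)) =
      SemidirectProduct.inl (trunc F n f) * (tt F ^ n * lamp F (f n) * (tt F ^ n)⁻¹) := by
  obtain ⟨w, hw, hw2⟩ := conj_lamp F (f n) n 1
  rw [hw, ← map_mul]
  congr 1
  apply Subtype.ext
  funext z
  change (if _ then _ else _) = (if _ then _ else _) * w.1 z
  rw [hw2 z]
  generalize z.toAdd = y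
  by_cases h1 : y = n
  · subst h1
    simp
  · by_cases h2 : 0 ≤ y ∧ y < n
    · have h3 : 0 ≤ y ∧ y < ((n + 1 : ℕ) : ℤ) := by push_cast; omega
      rw [if_pos h2, if_pos h3, if_neg h1, mul_one]
    · have h3 : ¬ (0 ≤ y ∧ y < ((n + 1 : ℕ) : ℤ)) := by push_cast; omega
      rw [if_neg h2, if_neg h3, if_neg h1, mul_one]

lemma trunc_single (a : F) (n j : ℕ) (hj : j < n) :
    (SemidirectProduct.inl (trunc F n (Pi.mulSingle j a)) : WreathProduct F (Multiplicative ℤ)) =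
      tt F ^ j * lamp F a * (tt F ^ j)⁻¹ := by
  obtain ⟨w, hw, hw2⟩ := conj_lamp F a j 1
  rw [hw]
  congr 1
  apply Subtype.ext
  funext z
  change (if _ then _ else _) = w.1 z
  rw [hw2 z]
  generalize z.toAdd = y
  by_cases h1 : y = j
  · subst h1
    simp [hj]
  · rw [if_neg h1]
    split_ifs with h
    · rw [Pi.mulSingle_eq_of_ne]
      omega
    · rfl

lemma trunc_congr (n : ℕ) (f g : ℕ → F) (h : ∀ i < n, f i = g i) : trunc F n f = trunc F n g := by
  apply Subtype.ext
  funext z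
  change (if _ then _ else _) = (if _ then _ else _)
  split_ifs with hz
  · exact h _ (by omega)
  · rfl

lemma lamp_ne (a : F) (ha : a ≠ 1) : lamp F a ≠ 1 := by
  intro h
  have h1 := SemidirectProduct.inl_injective (h.trans (map_one _).symm)
  have h2 := congrFun (congrArg Subtype.val h1) 1
  apply ha
  simpa [trunc] using h2

variable {F}

/-- Displacement of truncated elements. -/
lemma displ (φ : WreathProduct F (Multiplicative ℤ) →* Equiv.Perm I01) (D : Finset ℝ)
    (hF : ∀ (a : F) (x : I01), (φ (lamp F a) x : ℝ) - x ∈ D)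
    (ht : ∀ x : I01, (φ (tt F) x : ℝ) - x ∈ D)
    (ht' : ∀ x : I01, (φ (tt F)⁻¹ x : ℝ) - x ∈ D) (f : ℕ → F) (n : ℕ) (x : I01) :
    IsComb D (3 * n) ((φ (SemidirectProduct.inl (trunc F n f)) x : ℝ) - x) := by
  have step : ∀ (N : ℕ) (g h : WreathProduct F (Multiplicative ℤ)) (x : I01),
      (∀ y : I01, (φ g y : ℝ) - y ∈ D) → IsComb D N ((φ h x : ℝ) - x) →
      IsComb D (N + 1) ((φ (g * h) x : ℝ) - x) := by
    intro N g h x hg hh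
    have := isComb_add hh (hg (φ h x))
    rw [sub_add_sub_cancel] at this
    rw [map_mul]
    exact this
  have hpow : ∀ n : ℕ, IsComb D n ((φ ((tt F)⁻¹ ^ n) x : ℝ) - x) := by
    intro n
    induction n with
    | zero => simpa using isComb_zero D
    | succ n ih => rw [pow_succ']; exact step _ _ _ _ ht' ih
  have main : ∀ (n N : ℕ) (h : WreathProduct F (Multiplicative ℤ)), IsComb D N ((φ h x : ℝ) - x) →
      IsComb D (N + 2 * n)
        ((φ (SemidirectProduct.inl (trunc F n f) * tt F ^ n * h) x : ℝ) - x) := by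
    intro n
    induction n with
    | zero =>
      intro N h hh
      have h0 : trunc F 0 f = 1 := by
        rw [← map_one (trunc F 0)]
        exact trunc_congr F 0 _ _ (fun i hi => absurd hi (Nat.not_lt_zero i))
      simpa [h0] using hh
    | succ n ih =>
      intro N h hh
      have e := ih _ _ (step _ _ _ _ (hF (f n)) (step _ _ _ _ ht hh))
      have e2 : (SemidirectProduct.inl (trunc F (n + 1) f) * tt F ^ (n + 1) * h :
          WreathProduct F (Multiplicative ℤ)) =
          SemidirectProduct.inl (trunc F n f) * tt F ^ n * (lamp F (f n) * (tt F * h)) := by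
        rw [trunc_succ, pow_succ]
        group
      rw [e2]
      convert e using 1
      ring
  have := main n n _ (hpow n)
  rw [inv_pow, mul_inv_cancel_right] at this
  convert this using 1
  ring

end W

end IETWreath

/-- If `F` is a finite group and the wreath product `F ≀ ℤ` embeds in `IET`,
then `F` is abelian. -/
theorem abelian_of_wreath_by_Z_embeds_in_IET
    (F : Type*) [Group F] [Finite F]
    (φ : WreathProduct F (Multiplicative ℤ) →* Equiv.Perm I01)
    (hinj : Function.Injective φ) (hiet : ∀ g, IsIET (φ g)) :
    ∀ a b : F, a * b = b * a := by
  classical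
  intro a b
  by_contra hab
  set c := a * b * a⁻¹ * b⁻¹ with hc
  have hc1 : c ≠ 1 := by
    intro h
    apply hab
    rw [hc, mul_inv_eq_one, mul_inv_eq_iff_eq_mul] at h
    exact h
  have := Fintype.ofFinite F
  choose D hD using fun g => IETWreath.iet_displ (hiet g)
  let D0 : Finset ℝ := (Finset.univ.biUnion fun a : F => D (IETWreath.lamp F a)) ∪
    (D (IETWreath.tt F) ∪ D (IETWreath.tt F)⁻¹)
  have hdis := IETWreath.displ φ D0
    (fun a x => Finset.mem_union_left _ (Finset.mem_biUnion.mpr ⟨a, Finset.mem_univ a, hD _ x⟩))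
    (fun x => Finset.mem_union_right _ (Finset.mem_union_left _ (hD _ x)))
    (fun x => Finset.mem_union_right _ (Finset.mem_union_right _ (hD _ x)))
  set U := φ (IETWreath.lamp F c) with hU
  have hU1 : U ≠ 1 := by
    intro h
    exact IETWreath.lamp_ne F c hc1 (hinj (h.trans (map_one φ).symm))
  have hpos := IETWreath.iet_supp_pos (hiet _ : IsIET U) hU1
  obtain ⟨q, hq⟩ := ENNReal.exists_inv_nat_lt hpos.ne'
  have hq0 : 0 < q := by
    rcases Nat.eq_zero_or_pos q with rfl | h
    · simp at hq
    · exact h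
  have hmS := IETWreath.iet_measSupp (hiet _ : IsIET U)
  refine IETWreath.growth_contra (3 * q) (D0.card * 2) ?_
  intro m hm
  obtain ⟨x, B, hB, hBx, hBm⟩ := IETWreath.exists_many
    (fun j => φ ((IETWreath.tt F ^ j)⁻¹) ⁻¹' {x | U x ≠ x})
    (fun j => IETWreath.iet_measurable (hiet _) hmS) _
    (fun j => IETWreath.iet_preimage_ge (hiet _) _ hmS) q m hm hq hq0
  obtain ⟨Z, hZ, hZ2⟩ := IETWreath.comb_finset D0 (3 * (q * m))
  let ψ : (ℕ → F) →* Equiv.Perm I01 :=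
    φ.comp (SemidirectProduct.inl.comp (IETWreath.trunc F (q * m)))
  let S : Subgroup (ℕ → F) := (MulAction.stabilizer (Equiv.Perm I01) x).comap ψ
  have hS : ∀ f, f ∈ S ↔ ψ f x = x := fun f => Iff.rfl
  have hcount := IETWreath.bad_count_two S (q * m)
    (by
      intro f g hfg hf
      have : ψ g = ψ f := by
        simp only [ψ, MonoidHom.comp_apply]
        rw [IETWreath.trunc_congr F (q * m) f g hfg]
      rw [hS] at hf ⊢
      rw [this, hf])
    (fun f => (ψ f x : ℝ) - x) Z (fun f => hZ2 _ (hdis f _ x))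
    (by
      intro f g h
      have h2 : ψ f x = ψ g x := Subtype.ext (by linarith)
      rw [hS, map_mul, map_inv, Equiv.Perm.mul_apply, ← h2]
      exact (ψ f).symm_apply_apply x)
    a b B hB
    (by
      intro j hj hmem
      have hjx := hBx j hj
      rw [hS] at hmem
      apply hjx
      have e : ψ (Pi.mulSingle j c) =
          φ (IETWreath.tt F ^ j) * U * (φ (IETWreath.tt F ^ j))⁻¹ := by
        simp only [ψ, MonoidHom.comp_apply]
        rw [IETWreath.trunc_single F c (q * m) j (Finset.mem_range.mp (hB hj)), map_mul, map_mul,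
          map_inv]
      rw [← hc, e, Equiv.Perm.mul_apply, Equiv.Perm.mul_apply] at hmem
      rw [map_inv]
      exact (Equiv.Perm.eq_inv_iff_eq.mpr hmem))
  calc 2 ^ m ≤ 2 ^ B.card := Nat.pow_le_pow_right (by norm_num) hBm
    _ ≤ Z.card ^ 2 := hcount
    _ ≤ ((3 * (q * m) + 1) ^ D0.card) ^ 2 := Nat.pow_le_pow_left hZ 2
    _ = (3 * q * m + 1) ^ (D0.card * 2) := by rw [← pow_mul, mul_assoc]
end

section
/- There exists an uncountable family of subgroups of IET, pairwise non-isomorphic as abstract groups, each of which is generated by 3 elements and is solvable of derived length exactly 3 (its second derived subgroup is nontrivial and its third derived subgroup is trivial). -/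
open Set

theorem isIET_of_finite (T : Equiv.Perm I01) (D : Set ℝ) (hD : D.Finite)
    (h : ∀ t t' : I01, t ≤ t' → (∀ d ∈ D, ¬ ((t : ℝ) < d ∧ d ≤ t')) →
      (T t' : ℝ) - T t = t' - t) : IsIET T := by
  classical
  let F : Finset ℝ := (hD.toFinset.filter (fun d => 0 < d ∧ d < 1)) ∪ {0, 1}
  have h0F : (0 : ℝ) ∈ F := by simp [F]
  have h1F : (1 : ℝ) ∈ F := by simp [F]
  have hF : ∀ d ∈ F, 0 ≤ d ∧ d ≤ 1 := by
    intro d hd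
    simp only [F, Finset.mem_union, Finset.mem_filter, Finset.mem_insert,
      Finset.mem_singleton] at hd
    rcases hd with ⟨_, h1, h2⟩ | rfl | rfl
    · exact ⟨h1.le, h2.le⟩
    · norm_num
    · norm_num
  obtain ⟨n, hn⟩ : ∃ n, F.card = n + 1 :=
    Nat.exists_eq_succ_of_ne_zero (Finset.card_ne_zero_of_mem h0F)
  let a := F.orderEmbOfFin hn
  have hsurj : ∀ d ∈ F, ∃ j, a j = d := by
    intro d hd
    have : d ∈ Set.range a := by rw [Finset.range_orderEmbOfFin]; exact hd
    exact this
  have hmem : ∀ j, a j ∈ F := fun j => Finset.orderEmbOfFin_mem F hn j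
  have ha : StrictMono a := a.strictMono
  have ha0 : a 0 = 0 := by
    obtain ⟨j, hj⟩ := hsurj 0 h0F
    apply le_antisymm _ (hF _ (hmem 0)).1
    rw [← hj]; exact ha.monotone (Fin.zero_le j)
  have ha1 : a (Fin.last n) = 1 := by
    obtain ⟨j, hj⟩ := hsurj 1 h1F
    apply le_antisymm (hF _ (hmem _)).2
    rw [← hj]; exact ha.monotone (Fin.le_last j)
  refine ⟨n, a, ha, ha0, ha1, fun i => ?_⟩
  have hlt : a i.castSucc < a i.succ := ha i.castSucc_lt_succ
  have hi : a i.castSucc ∈ I01 :=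
    ⟨(hF _ (hmem _)).1, lt_of_lt_of_le hlt (hF _ (hmem _)).2⟩
  refine ⟨(T ⟨_, hi⟩ : ℝ) - a i.castSucc, fun x hx => ?_⟩
  have := h ⟨_, hi⟩ x hx.1 (by
    rintro d hd ⟨h1, h2⟩
    have hdF : d ∈ F := by
      simp only [F, Finset.mem_union, Finset.mem_filter, Set.Finite.mem_toFinset]
      left
      exact ⟨hd, lt_of_le_of_lt hi.1 h1, lt_of_le_of_lt h2 x.2.2⟩
    obtain ⟨j, hj⟩ := hsurj d hdF
    rw [← hj] at h1 h2
    have h3 := ha.lt_iff_lt.1 h1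
    have h4 := ha.lt_iff_lt.1 (lt_of_le_of_lt h2 hx.2)
    rw [Fin.lt_def] at h3 h4
    simp at h3 h4
    omega)
  simp only at this
  linarith

abbrev XX := Fin 3 × I01

/-- Piecewise translation property on the threefold cover. -/
def PT (g : Equiv.Perm XX) : Prop :=
  ∃ D : Set ℝ, D.Finite ∧ ∀ (k : Fin 3) (s s' : I01), (s : ℝ) ≤ s' →
    (∀ d ∈ D, ¬ ((s : ℝ) < d ∧ d ≤ s')) →
    (g (k, s')).1 = (g (k, s)).1 ∧ ((g (k, s')).2 : ℝ) - (g (k, s)).2 = s' - s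

theorem PT_mul {g h : Equiv.Perm XX} (hg : PT g) (hh : PT h) : PT (g * h) := by
  obtain ⟨Dg, fg, hg⟩ := hg
  obtain ⟨Dh, fh, hh⟩ := hh
  refine ⟨Dh ∪ (fun p : XX => (p.2 : ℝ)) '' (h ⁻¹' {p | (p.2 : ℝ) ∈ Dg}), ?_, ?_⟩
  · refine fh.union (Set.Finite.image _ (Set.Finite.preimage h.injective.injOn ?_))
    have : {p : XX | (p.2 : ℝ) ∈ Dg} = Set.univ ×ˢ ((fun t : I01 => (t : ℝ)) ⁻¹' Dg) := by
      ext; simp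
    rw [this]
    exact Set.finite_univ.prod (fg.preimage Subtype.val_injective.injOn)
  · intro k s s' hss hD
    obtain ⟨e1, e2⟩ := hh k s s' hss (fun d hd => hD d (Or.inl hd))
    have key := hg (h (k, s)).1 (h (k, s)).2 (h (k, s')).2 (by linarith) (by
      rintro d hd ⟨h1, h2⟩
      have hu : (s : ℝ) + (d - (h (k, s)).2) ∈ I01 :=
        ⟨by linarith [s.2.1], by linarith [s'.2.2]⟩
      obtain ⟨f1, f2⟩ := hh k s ⟨_, hu⟩ (by simp only; linarith) (by
        rintro d' hd' ⟨h3, h4⟩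
        exact hD d' (Or.inl hd') ⟨h3, by simp only at h4; linarith⟩)
      refine hD _ (Or.inr ⟨(k, ⟨_, hu⟩), ?_, rfl⟩) ⟨by simp only; linarith, by simp only; linarith⟩
      simp only [Set.mem_preimage, Set.mem_ofPred_eq]
      simp only at f2
      have : ((h (k, ⟨_, hu⟩)).2 : ℝ) = d := by linarith
      rw [this]; exact hd)
    simp only [Equiv.Perm.mul_apply]
    have e3 : h (k, s') = ((h (k, s)).1, (h (k, s')).2) := Prod.ext e1 rfl
    rw [e3]
    refine ⟨key.1, ?_⟩
    have := key.2
    simp only [Prod.mk.eta] at this ⊢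
    linarith

def PTsub : Subgroup (Equiv.Perm XX) where
  carrier := {g | PT g ∧ PT g⁻¹}
  one_mem' := by
    have : PT 1 := ⟨∅, Set.finite_empty, fun k s s' _ _ => ⟨rfl, rfl⟩⟩
    exact ⟨this, by simpa using this⟩
  mul_mem' := fun {a b} ha hb => ⟨PT_mul ha.1 hb.1, by
    rw [mul_inv_rev]; exact PT_mul hb.2 ha.2⟩
  inv_mem' := fun {a} ha => ⟨ha.2, by rw [inv_inv]; exact ha.1⟩

noncomputable def efun (p : XX) : I01 := ⟨((p.1 : ℕ) + (p.2 : ℝ)) / 3, by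
  have h1 := p.2.2.1
  have h2 := p.2.2.2
  have h3 : ((p.1 : ℕ) : ℝ) ≤ 2 := by exact_mod_cast Nat.le_of_lt_succ p.1.2
  have h4 : (0 : ℝ) ≤ ((p.1 : ℕ) : ℝ) := Nat.cast_nonneg _
  exact ⟨by positivity, by linarith⟩⟩

theorem efun_bij : Function.Bijective efun := by
  constructor
  · rintro ⟨k, s, hs⟩ ⟨k', s', hs'⟩ h
    have h : (((k : ℕ) : ℝ) + s) / 3 = (((k' : ℕ) : ℝ) + s') / 3 := congrArg Subtype.val h
    have h' : ((k : ℕ) : ℝ) + s = ((k' : ℕ) : ℝ) + s' := by linarith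
    have hk : (k : ℕ) = k' := by
      have a1 : ((k : ℕ) : ℝ) < (k' : ℕ) + 1 := by linarith [hs.1, hs'.2]
      have a2 : ((k' : ℕ) : ℝ) < (k : ℕ) + 1 := by linarith [hs.2, hs'.1]
      have a1 : (k : ℕ) < k' + 1 := by exact_mod_cast a1
      have a2 : (k' : ℕ) < k + 1 := by exact_mod_cast a2
      omega
    have hk' : k = k' := Fin.ext hk
    subst hk'
    have : s = s' := by linarith
    subst this
    rfl
  · rintro ⟨t, ht0, ht1⟩
    have h1 : (⌊3 * t⌋₊ : ℝ) ≤ 3 * t := Nat.floor_le (by linarith)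
    have h2 := Nat.lt_floor_add_one (3 * t)
    have h3 : ⌊3 * t⌋₊ < 3 := by
      have : (⌊3 * t⌋₊ : ℝ) < 3 := by linarith
      exact_mod_cast this
    refine ⟨(⟨⌊3 * t⌋₊, h3⟩, ⟨3 * t - ⌊3 * t⌋₊, by linarith, by linarith⟩), ?_⟩
    apply Subtype.ext
    simp only [efun]
    ring

noncomputable def ee : XX ≃ I01 := Equiv.ofBijective efun efun_bij

theorem ee_val (p : XX) : (ee p : ℝ) = ((p.1 : ℕ) + (p.2 : ℝ)) / 3 := rfl

theorem isIET_of_PT {g : Equiv.Perm XX} (hg : PT g) : IsIET (ee.permCongrHom g) := by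
  obtain ⟨D, fD, hg⟩ := hg
  refine isIET_of_finite _ (Set.range (fun k : Fin 3 => ((k : ℕ) : ℝ) / 3) ∪
    ⋃ k : Fin 3, (fun d => (((k : ℕ) : ℝ) + d) / 3) '' D) ?_ ?_
  · exact (Set.finite_range _).union (Set.finite_iUnion (fun k => fD.image _))
  · intro t t' htt hD
    obtain ⟨⟨k, s⟩, rfl⟩ := ee.surjective t
    obtain ⟨⟨k', s'⟩, rfl⟩ := ee.surjective t'
    have htt : (ee (k, s) : ℝ) ≤ ee (k', s') := htt
    have hs := s.2
    have hs' := s'.2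
    simp only [ee_val] at htt hD
    have hk : k = k' := by
      apply le_antisymm
      · have : ((k : ℕ) : ℝ) < (k' : ℕ) + 1 := by linarith [hs.1, hs'.2]
        have a1 : (k : ℕ) < k' + 1 := by exact_mod_cast this
        rw [Fin.le_def]; omega
      · by_contra hlt
        have hlt : (k : ℕ) + 1 ≤ k' := by rw [Fin.le_def] at hlt; omega
        have hlt : ((k : ℕ) : ℝ) + 1 ≤ (k' : ℕ) := by exact_mod_cast hlt
        exact hD _ (Or.inl ⟨k', rfl⟩) ⟨by simp only; linarith [hs.2], by simp only; linarith [hs'.1]⟩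
    subst hk
    have key := hg k s s' (by linarith) (by
      rintro d hd ⟨h1, h2⟩
      exact hD _ (Or.inr (Set.mem_iUnion.2 ⟨k, d, hd, rfl⟩))
        ⟨by simp only; linarith, by simp only; linarith⟩)
    have c : ∀ p, ee.permCongrHom g (ee p) = ee (g p) := by
      intro p
      simp [Equiv.permCongrHom]
    rw [c, c, ee_val, ee_val, ee_val, ee_val, key.1]
    have := key.2
    simp only
    linarith

open scoped commutatorElement

theorem perm_inv_self {α : Type*} (g : Equiv.Perm α) (p : α) : g (g⁻¹ p) = p :=
  g.apply_symm_apply p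

/-- Rotation of the unit interval. -/
noncomputable def rotC (a : ℝ) (s : I01) : I01 :=
  ⟨Int.fract ((s : ℝ) + a), Int.fract_nonneg _, Int.fract_lt_one _⟩

theorem rotC_add (a b : ℝ) (s : I01) : rotC a (rotC b s) = rotC (a + b) s := by
  apply Subtype.ext
  simp only [rotC]
  rw [Int.fract_eq_fract]
  refine ⟨-⌊(s : ℝ) + b⌋, ?_⟩
  have := Int.self_sub_floor ((s : ℝ) + b)
  push_cast
  rw [← this]; ring

theorem rotC_zero (s : I01) : rotC 0 s = s := by
  apply Subtype.ext
  simp only [rotC, add_zero]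
  exact Int.fract_eq_self.2 s.2

noncomputable def rot : Multiplicative ℝ →* Equiv.Perm XX :=
  MonoidHom.mk' (fun a =>
    { toFun := fun p => (p.1, rotC a.toAdd p.2)
      invFun := fun p => (p.1, rotC (-a.toAdd) p.2)
      left_inv := fun p => by simp [rotC_add, rotC_zero]
      right_inv := fun p => by simp [rotC_add, rotC_zero] }) (fun a b => by
        ext1 p
        simp [rotC_add])

theorem rot_apply (a : ℝ) (p : XX) : rot (Multiplicative.ofAdd a) p = (p.1, rotC a p.2) := rfl

theorem rot_inv_apply (a : ℝ) (p : XX) :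
    (rot (Multiplicative.ofAdd a))⁻¹ p = (p.1, rotC (-a) p.2) := rfl

def lamp : (I01 → Equiv.Perm (Fin 3)) →* Equiv.Perm XX :=
  MonoidHom.mk' (fun f =>
    { toFun := fun p => (f p.2 p.1, p.2)
      invFun := fun p => ((f p.2)⁻¹ p.1, p.2)
      left_inv := fun p => by simp
      right_inv := fun p => by simp }) (fun f g => by
        ext1 p
        simp)

theorem lamp_apply (f : I01 → Equiv.Perm (Fin 3)) (p : XX) : lamp f p = (f p.2 p.1, p.2) := rfl

theorem lamp_inj : Function.Injective lamp := by
  intro f g h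
  funext s
  ext1 k
  have := congrArg (fun u : Equiv.Perm XX => (u (k, s)).1) h
  exact this

theorem conj_lamp (a : ℝ) (f : I01 → Equiv.Perm (Fin 3)) :
    rot (Multiplicative.ofAdd a) * lamp f * (rot (Multiplicative.ofAdd a))⁻¹ =
      lamp (fun s => f (rotC (-a) s)) := by
  ext1 p
  rw [Equiv.Perm.mul_apply, Equiv.Perm.mul_apply, rot_inv_apply, lamp_apply, rot_apply]
  simp [lamp_apply, rotC_add, rotC_zero]

/-- Step function. -/
noncomputable def stp (b : ℝ) (σ : Equiv.Perm (Fin 3)) (s : I01) : Equiv.Perm (Fin 3) :=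
  if (s : ℝ) < b then σ else 1

theorem PT_lamp_stp (b : ℝ) (σ : Equiv.Perm (Fin 3)) : PT (lamp (stp b σ)) := by
  refine ⟨{b}, Set.finite_singleton b, fun k s s' hs hd => ?_⟩
  have hd := hd b rfl
  refine ⟨?_, rfl⟩
  simp only [lamp_apply]
  unfold stp
  split_ifs with h1 h2 h2
  · rfl
  · exact absurd (lt_of_le_of_lt hs h1) h2
  · exact absurd ⟨h2, not_lt.1 h1⟩ hd
  · rfl

theorem PTsub_lamp (b : ℝ) (σ : Equiv.Perm (Fin 3)) : lamp (stp b σ) ∈ PTsub := by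
  refine ⟨PT_lamp_stp b σ, ?_⟩
  rw [← map_inv]
  have : (stp b σ)⁻¹ = stp b σ⁻¹ := by
    funext s
    simp only [Pi.inv_apply, stp]
    split_ifs <;> simp
  rw [this]
  exact PT_lamp_stp _ _

theorem PT_rot (a : ℝ) : PT (rot (Multiplicative.ofAdd a)) := by
  refine ⟨{⌊a⌋ + 1 - a}, Set.finite_singleton _, fun k s s' hs hd => ⟨rfl, ?_⟩⟩
  have hd := hd _ rfl
  simp only [rot_apply, rotC]
  have h1 := Int.floor_le a
  have h2 := Int.lt_floor_add_one a
  have hfl : ⌊(s : ℝ) + a⌋ = ⌊(s' : ℝ) + a⌋ := by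
    by_cases h : (s' : ℝ) < ⌊a⌋ + 1 - a
    · have e1 : ⌊(s : ℝ) + a⌋ = ⌊a⌋ := by
        rw [Int.floor_eq_iff]; constructor <;> linarith [s.2.1]
      have e2 : ⌊(s' : ℝ) + a⌋ = ⌊a⌋ := by
        rw [Int.floor_eq_iff]; constructor <;> linarith [s'.2.1]
      rw [e1, e2]
    · have h' : ⌊a⌋ + 1 - a ≤ (s : ℝ) := by
        by_contra hc
        exact hd ⟨not_le.1 hc, not_lt.1 h⟩
      have e1 : ⌊(s : ℝ) + a⌋ = ⌊a⌋ + 1 := by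
        rw [Int.floor_eq_iff]; push_cast; constructor <;> linarith [s.2.2]
      have e2 : ⌊(s' : ℝ) + a⌋ = ⌊a⌋ + 1 := by
        rw [Int.floor_eq_iff]; push_cast; constructor <;> linarith [s'.2.2]
      rw [e1, e2]
  rw [← Int.self_sub_floor, ← Int.self_sub_floor, hfl]
  ring

theorem PTsub_rot (a : ℝ) : rot (Multiplicative.ofAdd a) ∈ PTsub := by
  refine ⟨PT_rot a, ?_⟩
  rw [← map_inv]
  exact PT_rot (-a)

/-- Permutations lying over a rotation. -/
def overRot : Subgroup (Equiv.Perm XX) where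
  carrier := {g | ∃ a : ℝ, ∀ p, (g p).2 = rotC a p.2}
  one_mem' := ⟨0, fun p => by simp [rotC_zero]⟩
  mul_mem' := by
    rintro g h ⟨a, ha⟩ ⟨b, hb⟩
    exact ⟨a + b, fun p => by rw [Equiv.Perm.mul_apply, ha, hb, rotC_add]⟩
  inv_mem' := by
    rintro g ⟨a, ha⟩
    refine ⟨-a, fun p => ?_⟩
    have := ha (g⁻¹ p)
    rw [perm_inv_self] at this
    rw [this, rotC_add]; simp [rotC_zero]

theorem mem_lamp_range {g : Equiv.Perm XX} (h : ∀ p, (g p).2 = p.2) : g ∈ lamp.range := by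
  have h' : ∀ p, (g⁻¹ p).2 = p.2 := by
    intro p
    have := h (g⁻¹ p)
    rw [perm_inv_self] at this
    exact this.symm
  have e1 : ∀ k s, g (k, s) = ((g (k, s)).1, s) := fun k s => Prod.ext rfl (h _)
  have e2 : ∀ k s, g⁻¹ (k, s) = ((g⁻¹ (k, s)).1, s) := fun k s => Prod.ext rfl (h' _)
  refine ⟨fun s => ⟨fun k => (g (k, s)).1, fun k => (g⁻¹ (k, s)).1, fun k => ?_, fun k => ?_⟩, ?_⟩
  · change (g⁻¹ ((g (k, s)).1, s)).1 = k
    rw [← e1]; simp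
  · change (g ((g⁻¹ (k, s)).1, s)).1 = k
    rw [← e2]; simp
  · ext1 p
    exact (e1 p.1 p.2).symm

theorem comm_overRot : ⁅overRot, overRot⁆ ≤ lamp.range := by
  rw [Subgroup.commutator_le]
  intro g hg h hh
  have hg' := overRot.inv_mem hg
  obtain ⟨a, ha⟩ := hg
  obtain ⟨b, hb⟩ := hh
  apply mem_lamp_range
  have ia : ∀ p, (g⁻¹ p).2 = rotC (-a) p.2 := by
    intro p
    have := ha (g⁻¹ p)
    rw [perm_inv_self] at this
    rw [this, rotC_add]; simp [rotC_zero]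
  have ib : ∀ p, (h⁻¹ p).2 = rotC (-b) p.2 := by
    intro p
    have := hb (h⁻¹ p)
    rw [perm_inv_self] at this
    rw [this, rotC_add]; simp [rotC_zero]
  intro p
  rw [commutatorElement_def, Equiv.Perm.mul_apply, Equiv.Perm.mul_apply, Equiv.Perm.mul_apply,
    ha, hb, ia, ib, rotC_add, rotC_add, rotC_add]
  have : a + b + -a + -b = 0 := by ring
  have : a + (b + (-a + -b)) = 0 := by ring
  simp [rotC_zero]

theorem derived_S3 : derivedSeries (Equiv.Perm (Fin 3)) 2 = ⊥ := by
  have h1 : derivedSeries (Equiv.Perm (Fin 3)) 1 ≤ alternatingGroup (Fin 3) := by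
    rw [derivedSeries_one]
    exact Abelianization.commutator_subset_ker _
  rw [eq_bot_iff, derivedSeries_succ]
  refine (Subgroup.commutator_mono h1 h1).trans ?_
  rw [Subgroup.commutator_le]
  have : ∀ g h : Equiv.Perm (Fin 3), Equiv.Perm.sign g = 1 → Equiv.Perm.sign h = 1 →
    g * h * g⁻¹ * h⁻¹ = 1 := by decide
  intro g hg h hh
  exact this g h hg hh

theorem derived_pi : derivedSeries (I01 → Equiv.Perm (Fin 3)) 2 = ⊥ := by
  rw [eq_bot_iff]
  intro f hf
  rw [Subgroup.mem_bot]
  funext s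
  have := map_derivedSeries_le_derivedSeries (Pi.evalMonoidHom (fun _ : I01 => Equiv.Perm (Fin 3)) s) 2
    (Subgroup.mem_map_of_mem _ hf)
  rw [derived_S3] at this
  exact this

theorem derived_three (G : Subgroup (Equiv.Perm XX)) (hG : G ≤ overRot) :
    derivedSeries G 3 = ⊥ := by
  have h0 : (derivedSeries G 0).map G.subtype ≤ overRot := by
    rintro _ ⟨g, _, rfl⟩
    exact hG g.2
  have h1 : (derivedSeries G 1).map G.subtype ≤ (derivedSeries (I01 → Equiv.Perm (Fin 3)) 0).map lamp := by
    rw [derivedSeries_succ, Subgroup.map_commutator]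
    refine (Subgroup.commutator_mono h0 h0).trans (comm_overRot.trans ?_)
    rw [derivedSeries_zero, MonoidHom.range_eq_map]
  have h2 : (derivedSeries G 2).map G.subtype ≤ (derivedSeries (I01 → Equiv.Perm (Fin 3)) 1).map lamp := by
    rw [derivedSeries_succ G, Subgroup.map_commutator,
      derivedSeries_succ (I01 → Equiv.Perm (Fin 3)), Subgroup.map_commutator]
    exact Subgroup.commutator_mono h1 h1
  have h3 : (derivedSeries G 3).map G.subtype ≤ (derivedSeries (I01 → Equiv.Perm (Fin 3)) 2).map lamp := by
    rw [derivedSeries_succ G, Subgroup.map_commutator,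
      derivedSeries_succ (I01 → Equiv.Perm (Fin 3)), Subgroup.map_commutator]
    exact Subgroup.commutator_mono h2 h2
  rw [derived_pi, Subgroup.map_bot, le_bot_iff] at h3
  exact (Subgroup.map_eq_bot_iff_of_injective _ G.subtype_injective).1 h3

theorem derived_equiv {A B : Type*} [Group A] [Group B] (e : A ≃* B) (n : ℕ) :
    derivedSeries A n = ⊥ ↔ derivedSeries B n = ⊥ := by
  have h := map_derivedSeries_eq (f := e.toMonoidHom) e.surjective n
  rw [← h, Subgroup.map_eq_bot_iff_of_injective _ e.injective]

noncomputable def gx : Equiv.Perm XX := rot (Multiplicative.ofAdd (√2))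
noncomputable def gy (b : ℝ) : Equiv.Perm XX := lamp (stp b (Equiv.swap 0 1))
noncomputable def gz (b : ℝ) : Equiv.Perm XX := lamp (stp b (Equiv.swap 1 2))

noncomputable def KK (b : ℝ) : Subgroup (Equiv.Perm XX) := Subgroup.closure {gx, gy b, gz b}

theorem KK_over (b : ℝ) : KK b ≤ overRot := by
  rw [KK, Subgroup.closure_le]
  rintro g (rfl | rfl | rfl)
  · exact ⟨√2, fun p => rfl⟩
  · exact ⟨0, fun p => (rotC_zero _).symm⟩
  · exact ⟨0, fun p => (rotC_zero _).symm⟩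

theorem KK_PT (b : ℝ) : KK b ≤ PTsub := by
  rw [KK, Subgroup.closure_le]
  rintro g (rfl | rfl | rfl)
  · exact PTsub_rot _
  · exact PTsub_lamp _ _
  · exact PTsub_lamp _ _

theorem gx_mem (b : ℝ) : gx ∈ KK b := Subgroup.subset_closure (by simp)
theorem gy_mem (b : ℝ) : gy b ∈ KK b := Subgroup.subset_closure (by simp)
theorem gz_mem (b : ℝ) : gz b ∈ KK b := Subgroup.subset_closure (by simp)

theorem comm_gx (b : ℝ) (hb : 0 < b) (hb' : b < 1 / 2) (σ : Equiv.Perm (Fin 3)) :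
    ∃ f, ⁅gx, lamp (stp b σ)⁆ = lamp f ∧ f ⟨0, by norm_num, by norm_num⟩ = σ⁻¹ := by
  refine ⟨(fun s => stp b σ (rotC (-√2) s)) * (stp b σ)⁻¹, ?_, ?_⟩
  · rw [commutatorElement_def, gx, conj_lamp, ← map_inv, ← map_mul]
  · have h1 : (1.4 : ℝ) < √2 := Real.lt_sqrt_of_sq_lt (by norm_num)
    have h2 : √2 < (1.5 : ℝ) := by rw [Real.sqrt_lt' (by norm_num)]; norm_num
    have h3 : Int.fract (0 + -√2) = 2 - √2 := by
      rw [Int.fract_eq_iff]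
      exact ⟨by linarith, by linarith, -2, by push_cast; ring⟩
    have h4 : ¬ (Int.fract (0 + -√2) < b) := by rw [h3]; linarith
    have e1 : stp b σ (rotC (-√2) ⟨0, by norm_num, by norm_num⟩) = 1 := if_neg h4
    have e2 : stp b σ ⟨0, by norm_num, by norm_num⟩ = σ := if_pos hb
    rw [Pi.mul_apply, Pi.inv_apply, e1, e2, one_mul]

theorem derived_two (b : ℝ) (hb : 0 < b) (hb' : b < 1 / 2) : derivedSeries (KK b) 2 ≠ ⊥ := by
  intro h
  let x : KK b := ⟨gx, gx_mem b⟩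
  let y : KK b := ⟨gy b, gy_mem b⟩
  let z : KK b := ⟨gz b, gz_mem b⟩
  have m : ∀ u v : KK b, ⁅u, v⁆ ∈ derivedSeries (KK b) 1 := fun u v =>
    Subgroup.commutator_mem_commutator (Subgroup.mem_top _) (Subgroup.mem_top _)
  have hm : ⁅⁅x, y⁆, ⁅x, z⁆⁆ ∈ derivedSeries (KK b) 2 :=
    Subgroup.commutator_mem_commutator (m x y) (m x z)
  rw [h, Subgroup.mem_bot] at hm
  have hm : ⁅⁅gx, gy b⁆, ⁅gx, gz b⁆⁆ = 1 := congrArg Subtype.val hm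
  obtain ⟨f, hf, hf0⟩ := comm_gx b hb hb' (Equiv.swap 0 1)
  obtain ⟨g, hg, hg0⟩ := comm_gx b hb hb' (Equiv.swap 1 2)
  rw [gy, gz, hf, hg, ← map_commutatorElement, ← map_one lamp] at hm
  have := congrFun (lamp_inj hm) ⟨0, by norm_num, by norm_num⟩
  simp only [commutatorElement_def, Pi.mul_apply, Pi.inv_apply, hf0, hg0, Pi.one_apply] at this
  revert this
  decide

theorem commute_iff (b : ℝ) (n : ℤ) :
    Commute (gy b) (gx ^ n * gz b * (gx ^ n)⁻¹) ↔
      ∀ s : I01, ¬ ((s : ℝ) < b ∧ Int.fract ((s : ℝ) - n * √2) < b) := by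
  have e : gx ^ n = rot (Multiplicative.ofAdd (n * √2)) := by
    rw [gx, ← map_zpow, ← ofAdd_zsmul, zsmul_eq_mul]
  rw [e, gz, conj_lamp, gy, commute_iff_eq, ← map_mul, ← map_mul, lamp_inj.eq_iff, funext_iff]
  refine forall_congr' fun s => ?_
  simp only [Pi.mul_apply, stp, rotC, ← sub_eq_add_neg]
  by_cases h1 : (s : ℝ) < b <;> by_cases h2 : Int.fract ((s : ℝ) - n * √2) < b
  · simp only [h1, h2, if_true]
    simp only [and_self, not_true, iff_false]
    decide
  · simp [h1, h2]
  · simp [h1, h2]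
  · simp [h1, h2]

theorem distinguish (b c : ℝ) (hb : 0 < b) (hbc : b < c) (hc : c < 1 / 2) :
    ∃ n : ℤ, Commute (gy b) (gx ^ n * gz b * (gx ^ n)⁻¹) ∧
      ¬ Commute (gy c) (gx ^ n * gz c * (gx ^ n)⁻¹) := by
  have hd : Dense (AddSubgroup.closure {√2, (1 : ℝ)} : Set ℝ) := by
    rw [dense_addSubgroupClosure_pair_iff, div_one]
    exact irrational_sqrt_two
  obtain ⟨d, hd, h1, h2⟩ := hd.exists_between hbc
  obtain ⟨n, m, hnm⟩ := AddSubgroup.mem_closure_pair.1 hd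
  simp only [zsmul_eq_mul, mul_one] at hnm
  refine ⟨n, (commute_iff b n).2 ?_, fun hcom => ?_⟩
  · rintro s ⟨h3, h4⟩
    have : Int.fract ((s : ℝ) - n * √2) = s - d + 1 := by
      rw [Int.fract_eq_iff]
      exact ⟨by linarith [s.2.1], by linarith, m - 1, by push_cast; linarith⟩
    rw [this] at h4
    linarith [s.2.1]
  · refine (commute_iff c n).1 hcom ⟨d, by linarith, by linarith⟩ ⟨h2, ?_⟩
    have : d - n * √2 = (m : ℝ) := by linarith
    simp only
    rw [this, Int.fract_intCast]
    linarith

theorem closure_three_countable {Γ : Type*} [Group Γ] (x y z : Γ) :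
    Countable (Subgroup.closure {x, y, z}) := by
  have : Countable (FreeGroup (Fin 3)) := by
    unfold FreeGroup
    infer_instance
  have h : Subgroup.closure {x, y, z} = (FreeGroup.lift ![x, y, z]).range := by
    rw [FreeGroup.range_lift_eq_closure]
    congr 1
    ext t
    simp [eq_comm]
    tauto
  rw [h]
  exact (FreeGroup.lift ![x, y, z]).rangeRestrict_surjective.countable

abbrev BB := Set.Ioo (0 : ℝ) (1 / 2)

def isoSetoid : Setoid BB where
  r b c := Nonempty (KK b ≃* KK c)
  iseqv := ⟨fun _ => ⟨MulEquiv.refl _⟩, fun ⟨e⟩ => ⟨e.symm⟩, fun ⟨e⟩ ⟨f⟩ => ⟨e.trans f⟩⟩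

theorem class_countable (b : BB) : {c : BB | Nonempty (KK c ≃* KK b)}.Countable := by
  have : Countable (KK b) := closure_three_countable _ _ _
  let S := {c : BB // Nonempty (KK c ≃* KK b)}
  let e : ∀ c : S, KK c.1 ≃* KK b := fun c => Classical.choice c.2
  let F : S → KK b × KK b × KK b := fun c =>
    (e c ⟨gx, gx_mem _⟩, e c ⟨gy c.1, gy_mem _⟩, e c ⟨gz c.1, gz_mem _⟩)
  have key : ∀ (c : S) (n : ℤ), Commute (gy c.1) (gx ^ n * gz c.1 * (gx ^ n)⁻¹) ↔
      Commute (F c).2.1 ((F c).1 ^ n * (F c).2.2 * ((F c).1 ^ n)⁻¹) := by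
    intro c n
    simp only [F, ← map_zpow, ← map_mul, ← map_inv, commute_iff_eq]
    rw [(e c).injective.eq_iff, Subtype.ext_iff]
    rfl
  have hF : Function.Injective F := by
    intro c d hcd
    rcases lt_trichotomy (c.1 : ℝ) d.1 with h | h | h
    · obtain ⟨n, h1, h2⟩ := distinguish _ _ c.1.2.1 h d.1.2.2
      rw [key] at h1 h2
      rw [hcd] at h1
      exact absurd h1 h2
    · exact Subtype.ext (Subtype.ext h)
    · obtain ⟨n, h1, h2⟩ := distinguish _ _ d.1.2.1 h c.1.2.2
      rw [key] at h1 h2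
      rw [hcd] at h2
      exact absurd h1 h2
  exact hF.countable

theorem quot_uncountable : ¬ Countable (Quotient isoSetoid) := by
  intro hq
  have h : (Set.univ : Set BB).Countable := by
    have : (Set.univ : Set BB) = ⋃ q : Quotient isoSetoid, {c : BB | Nonempty (KK c ≃* KK q.out)} := by
      symm
      rw [Set.eq_univ_iff_forall]
      intro c
      refine Set.mem_iUnion.2 ⟨Quotient.mk isoSetoid c, ?_⟩
      have : isoSetoid.r c (Quotient.mk isoSetoid c).out :=
        isoSetoid.symm (Quotient.mk_out c)
      exact this
    rw [this]
    exact Set.countable_iUnion fun q => class_countable _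
  have h2 : (BB).Countable := Set.countable_coe_iff.1 (Set.countable_univ_iff.1 h)
  rw [← Cardinal.le_aleph0_iff_set_countable,
    Cardinal.mk_Ioo_real (by norm_num : (0 : ℝ) < 1 / 2)] at h2
  exact absurd h2 (not_le.2 Cardinal.aleph0_lt_continuum)

noncomputable def GG (b : ℝ) : Subgroup (Equiv.Perm I01) := (KK b).map ee.permCongrHom.toMonoidHom

noncomputable def GGe (b : ℝ) : KK b ≃* GG b := ee.permCongrHom.subgroupMap (KK b)

/-- There exist uncountably many pairwise non-isomorphic 3-generated subgroups of `IET`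
that are solvable of derived length exactly 3. -/
theorem uncountably_many_three_generated_derived_length_three_subgroups :
    ∃ S : Set (Subgroup (Equiv.Perm I01)),
      ¬ S.Countable ∧
      (∀ G ∈ S, (∀ g ∈ G, IsIET g) ∧
        (∃ x y z : Equiv.Perm I01, Subgroup.closure {x, y, z} = G) ∧
        derivedSeries ↥G 3 = ⊥ ∧ derivedSeries ↥G 2 ≠ ⊥) ∧
      (∀ G ∈ S, ∀ H ∈ S, G ≠ H → IsEmpty (↥G ≃* ↥H)) := by
  have hiso : ∀ q r : Quotient isoSetoid, Nonempty (GG q.out ≃* GG r.out) → q = r := by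
    rintro q r ⟨f⟩
    have : isoSetoid.r q.out r.out := ⟨((GGe _).trans f).trans (GGe _).symm⟩
    rw [← Quotient.out_eq q, ← Quotient.out_eq r]
    exact Quotient.sound this
  refine ⟨Set.range (fun q : Quotient isoSetoid => GG q.out), ?_, ?_, ?_⟩
  · intro hc
    have hinj : Function.Injective (fun q : Quotient isoSetoid => GG q.out) := by
      intro q r h
      simp only at h
      apply hiso
      rw [h]
      exact ⟨MulEquiv.refl _⟩
    have := hc.to_subtype
    exact quot_uncountable (Set.rangeFactorization_injective.2 hinj).countable
  · rintro _ ⟨q, rfl⟩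
    refine ⟨?_, ?_, ?_, ?_⟩
    · rintro _ ⟨g, hg, rfl⟩
      exact isIET_of_PT (KK_PT _ hg).1
    · refine ⟨ee.permCongrHom gx, ee.permCongrHom (gy q.out), ee.permCongrHom (gz q.out), ?_⟩
      simp only [GG, KK]
      rw [MonoidHom.map_closure]
      congr 1
      simp [Set.image_insert_eq]
    · exact (derived_equiv (GGe _) 3).1 (derived_three _ (KK_over _))
    · intro h
      exact derived_two _ q.out.2.1 q.out.2.2 ((derived_equiv (GGe _) 2).2 h)
  · rintro _ ⟨q, rfl⟩ _ ⟨r, rfl⟩ hne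
    refine ⟨fun f => hne ?_⟩
    simp only [hiso q r ⟨f⟩]
end
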